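/- arXiv:1410.3149 — 2 statements merged into one kernel-verified Lean document; each statement's English description precedes it below -/
import Mathlib

section
/- Fix a positive integer n and let λ ∈ ℝ^n be strictly decreasing: λ_1 > λ_2 > … > λ_n. Let D = diag(λ_1, …, λ_n) and let ν be the pushforward of the Haar probability measure on the unitary group U(n) under the map U ↦ ( l_i((U D U*)^{(k)}) )_{1 ≤ i ≤ k ≤ n−1} ∈ ℝ^{n(n−1)/2}, where A^{(k)} denotes the top-left k×k principal submatrix. Then ν equals the uniform (normalized Lebesgue) probability measure on the Gelfand–Zeitlin polytope P_λ ⊂ ℝ^{n(n−1)/2}, which consists of all families (x^k_i)_{1 ≤ i ≤ k ≤ n−1} such that, setting x^n_i := λ_1 + … + λ_i for 1 ≤ i ≤ n and x^k_0 := 0 for all k, the inequalities x^{k+1}_i + x^k_{i−1} ≥ x^{k+1}_{i−1} + x^k_i and x^{k+1}_i + x^k_i ≥ x^{k+1}_{i+1} + x^k_{i−1} hold for all 1 ≤ i ≤ k ≤ n−1. (P_λ has positive Lebesgue measure since λ is strictly decreasing.) -/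
open Matrix

/-- The eigenvalues of a Hermitian matrix, listed in decreasing order:
`eigsDesc hA 0 = λ₁ ≥ eigsDesc hA 1 = λ₂ ≥ …`. -/
noncomputable def eigsDesc {n : ℕ} {A : Matrix (Fin n) (Fin n) ℂ} (hA : A.IsHermitian) :
    Fin n → ℝ :=
  fun i => hA.eigenvalues (Tuple.sort hA.eigenvalues i.rev)
/-- `lMap hA i = λ₁ + … + λ_{i+1}`, the partial sums of the decreasingly ordered
eigenvalues of a Hermitian matrix (`i : Fin n` represents the index `i+1`). -/
noncomputable def lMap {n : ℕ} {A : Matrix (Fin n) (Fin n) ℂ} (hA : A.IsHermitian) :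
    Fin n → ℝ :=
  fun i => ∑ j ∈ Finset.Iic i, eigsDesc hA j

/-- The `(k, i)` entry of the Gelfand–Zeitlin tableau of a Hermitian matrix:
`lᵢ(A^{(k)})` for `1 ≤ i ≤ k ≤ n` (where `A^{(k)}` is the top-left `k × k`
principal submatrix) and `0` otherwise; in particular `lᵏ₀ = 0`. -/
noncomputable def LH {n : ℕ} {A : Matrix (Fin n) (Fin n) ℂ} (hA : A.IsHermitian)
    (k i : ℕ) : ℝ :=
  if h : 1 ≤ i ∧ i ≤ k ∧ k ≤ n then
    lMap (hA.submatrix (Fin.castLE h.2.2)) ⟨i - 1, by omega⟩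
  else 0

/-- The decreasingly ordered eigenvalues of the top-left `k × k` principal submatrix
of a Hermitian matrix (`i : Fin k` represents `λ_{i+1}(A^{(k)})`). -/
noncomputable def eigP {n : ℕ} {A : Matrix (Fin n) (Fin n) ℂ} (hA : A.IsHermitian)
    (k : ℕ) (hk : k ≤ n) : Fin k → ℝ :=
  eigsDesc (hA.submatrix (Fin.castLE hk))

noncomputable instance matrixMeasurableSpace (n : ℕ) :
    MeasurableSpace (Matrix (Fin n) (Fin n) ℂ) :=
  MeasurableSpace.pi

/-- `U D U*` is Hermitian for `D` a real diagonal matrix and `U` unitary. -/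
theorem conj_diagonal_isHermitian (n : ℕ) (lam : Fin n → ℝ)
    (U : Matrix.unitaryGroup (Fin n) ℂ) :
    ((U : Matrix (Fin n) (Fin n) ℂ) * Matrix.diagonal (fun i => (lam i : ℂ)) *
      (U : Matrix (Fin n) (Fin n) ℂ)ᴴ).IsHermitian :=
  Matrix.isHermitian_mul_mul_conjTranspose _
    (Matrix.isHermitian_diagonal_iff.mpr fun i => Complex.conj_ofReal (lam i))

/-- The Gelfand–Zeitlin map `U ↦ (lᵢ((U D U*)^{(k)}))_{1 ≤ i ≤ k ≤ n-1}`, where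
`D = diag(λ)`; the index `⟨k', i'⟩ : Σ k' : Fin (n-1), Fin (k'+1)` encodes the pair
`(k, i) = (k' + 1, i' + 1)`. -/
noncomputable def gzPoint (n : ℕ) (lam : Fin n → ℝ)
    (U : Matrix.unitaryGroup (Fin n) ℂ) :
    (Σ k : Fin (n - 1), Fin ((k : ℕ) + 1)) → ℝ :=
  fun p => LH (conj_diagonal_isHermitian n lam U) ((p.1 : ℕ) + 1) ((p.2 : ℕ) + 1)

/-- The full triangular tableau associated to a point
`x ∈ ℝ^{n(n-1)/2}`: rows `1 ≤ k ≤ n-1` are given by `x`, the top row `k = n` is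
given by the partial sums `λ₁ + … + λᵢ`, and the entries `lᵏ₀` are `0`. -/
noncomputable def gzFull (n : ℕ) (lam : Fin n → ℝ)
    (x : (Σ k : Fin (n - 1), Fin ((k : ℕ) + 1)) → ℝ) (k i : ℕ) : ℝ :=
  if i = 0 then 0
  else if h : 1 ≤ k ∧ k ≤ n - 1 ∧ 1 ≤ i ∧ i ≤ k then
    x ⟨⟨k - 1, by omega⟩, ⟨i - 1, by show i - 1 < k - 1 + 1; omega⟩⟩
  else if h2 : k = n ∧ 1 ≤ i ∧ i ≤ n then
    ∑ j ∈ Finset.univ.filter (fun j : Fin n => (j : ℕ) < i), lam j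
  else 0

/-- The Gelfand–Zeitlin polytope `P_λ ⊂ ℝ^{n(n-1)/2}`: points whose associated full
tableau (with top row the partial sums of `λ`) satisfies the interlacing
inequalities. -/
def gzPolytope (n : ℕ) (lam : Fin n → ℝ) :
    Set ((Σ k : Fin (n - 1), Fin ((k : ℕ) + 1)) → ℝ) :=
  {x | ∀ k i : ℕ, 1 ≤ i → i ≤ k → k < n →
    gzFull n lam x (k + 1) i + gzFull n lam x k (i - 1) ≥
        gzFull n lam x (k + 1) (i - 1) + gzFull n lam x k i ∧
    gzFull n lam x (k + 1) i + gzFull n lam x k i ≥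
        gzFull n lam x (k + 1) (i + 1) + gzFull n lam x k (i - 1)}

open Polynomial in
/-- The monic polynomial with prescribed roots. -/
noncomputable def gzQ {m : ℕ} (mu : Fin m → ℝ) : ℝ[X] := ∏ k, (X - C (mu k))

namespace GZ
open Polynomial

lemma gzQ_monic {m : ℕ} (mu : Fin m → ℝ) : (gzQ mu).Monic := monic_prod_X_sub_C _ _

lemma gzQ_natDegree {m : ℕ} (mu : Fin m → ℝ) : (gzQ mu).natDegree = m := by
  simp [gzQ]

lemma gzQ_coeff {m : ℕ} (mu : Fin m → ℝ) : (gzQ mu).coeff m = 1 := by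
  have := (gzQ_monic mu).coeff_natDegree
  rwa [gzQ_natDegree] at this

lemma gzQ_eval {m : ℕ} (mu : Fin m → ℝ) (x : ℝ) : (gzQ mu).eval x = ∏ k, (x - mu k) := by
  simp [gzQ, eval_prod]

lemma gzQ_degree {m : ℕ} (mu : Fin m → ℝ) : (gzQ mu).degree = m := by
  rw [degree_eq_natDegree (gzQ_monic mu).ne_zero, gzQ_natDegree]

lemma degree_C_mul_gzQ {m : ℕ} (s : ℝ) (mu : Fin m → ℝ) : (C s * gzQ mu).degree ≤ m := by
  refine (degree_mul_le _ _).trans ?_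
  rw [gzQ_degree]
  refine (add_le_add_left degree_C_le _).trans ?_
  simp

lemma gzQ_inj {m : ℕ} {mu nu : Fin m → ℝ} (hmu : Antitone mu) (hnu : Antitone nu)
    (h : gzQ mu = gzQ nu) : mu = nu := by
  have key : ∀ f : Fin m → ℝ, (gzQ f).roots = ((List.ofFn f : List ℝ) : Multiset ℝ) := by
    intro f
    rw [gzQ, ← roots_multiset_prod_X_sub_C ((List.ofFn f : List ℝ) : Multiset ℝ)]
    congr 1
    simp [List.prod_ofFn, List.map_ofFn]
  have h2 := congrArg roots h
  rw [key, key, Multiset.coe_eq_coe] at h2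
  have := List.Perm.eq_of_sortedGE (List.sortedGE_ofFn_iff.2 hmu) (List.sortedGE_ofFn_iff.2 hnu) h2
  exact List.ofFn_injective this

lemma poly_eq {m : ℕ} {x : Fin (m+1) → ℝ} (hx : Function.Injective x) {p q : ℝ[X]}
    (hp : p.degree ≤ m) (hq : q.degree ≤ m) (h : ∀ i, p.eval (x i) = q.eval (x i)) : p = q := by
  have hlt : ((m : ℕ) : WithBot ℕ) < ((Finset.univ : Finset (Fin (m+1))).card : WithBot ℕ) := by
    simp only [Finset.card_univ, Fintype.card_fin]
    exact_mod_cast Nat.lt_succ_self m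
  exact eq_of_degrees_lt_of_eval_index_eq Finset.univ hx.injOn (lt_of_le_of_lt hp hlt)
    (lt_of_le_of_lt hq hlt) (fun i _ => h i)

lemma smul_gzQ_inj {m : ℕ} {x : Fin (m+1) → ℝ} (hx : Function.Injective x) {s s' : ℝ}
    {mu nu : Fin m → ℝ} (hmu : Antitone mu) (hnu : Antitone nu) (hs : s ≠ 0)
    (h : ∀ i, s * ∏ k, (x i - mu k) = s' * ∏ k, (x i - nu k)) : s = s' ∧ mu = nu := by
  have hdeg : ∀ (s : ℝ) (f : Fin m → ℝ), (C s * gzQ f).degree ≤ m := degree_C_mul_gzQ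
  have e : C s * gzQ mu = C s' * gzQ nu := by
    refine poly_eq hx (hdeg _ _) (hdeg _ _) fun i => ?_
    simpa [gzQ_eval] using h i
  have e1 : s = s' := by
    have := congrArg (fun p => coeff p m) e
    simpa [gzQ_coeff] using this
  subst e1
  exact ⟨rfl, gzQ_inj hmu hnu (mul_left_cancel₀ (C_ne_zero.2 hs) e)⟩

lemma evals_inj {m : ℕ} {x : Fin (m+1) → ℝ} (hx : Function.Injective x)
    {mu nu : Fin m → ℝ} (hmu : Antitone mu) (hnu : Antitone nu)
    (h : ∀ i, ∏ k, (x i - mu k) = ∏ k, (x i - nu k)) : mu = nu :=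
  (smul_gzQ_inj hx (s := 1) (s' := 1) hmu hnu one_ne_zero (fun i => by rw [h])).2

/-- strict interlacing set -/
def inter {m : ℕ} (lam : Fin (m+1) → ℝ) : Set (Fin m → ℝ) :=
  Set.pi Set.univ fun k => Set.Ioo (lam k.succ) (lam k.castSucc)

lemma inter_strictAnti {m : ℕ} {lam : Fin (m+1) → ℝ} (hlam : StrictAnti lam) {mu : Fin m → ℝ}
    (h : mu ∈ inter lam) : StrictAnti mu := by
  intro a b hab
  have ha := (h a (Set.mem_univ _)).1
  have hb := (h b (Set.mem_univ _)).2
  have : lam b.castSucc ≤ lam a.succ := hlam.antitone (by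
    rw [Fin.le_def]; simpa using hab)
  linarith

/-- parametrization of the positive orthant by scale and interlacing roots -/
noncomputable def Psi {m : ℕ} (lam : Fin (m+1) → ℝ) (v : Fin (m+1) → ℝ) : Fin (m+1) → ℝ :=
  fun i => v 0 * ((∏ k : Fin m, (lam i - v k.succ)) / ∏ k, (lam i - lam (i.succAbove k)))

lemma d_ne {m : ℕ} {lam : Fin (m+1) → ℝ} (hlam : Function.Injective lam) (i : Fin (m+1)) :
    ∏ k, (lam i - lam (i.succAbove k)) ≠ 0 := by
  refine Finset.prod_ne_zero_iff.2 fun k _ => sub_ne_zero.2 fun h => ?_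
  exact Fin.succAbove_ne i k (hlam h).symm

/-- interpolation polynomial -/
noncomputable def PP {m : ℕ} (lam t : Fin (m+1) → ℝ) : ℝ[X] :=
  ∑ i, C (t i) * gzQ (fun k => lam (i.succAbove k))

lemma PP_degree {m : ℕ} (lam t : Fin (m+1) → ℝ) : (PP lam t).degree ≤ m := by
  refine (degree_sum_le _ _).trans (Finset.sup_le fun i _ => ?_)
  exact degree_C_mul_gzQ _ _

lemma PP_coeff {m : ℕ} (lam t : Fin (m+1) → ℝ) : (PP lam t).coeff m = ∑ i, t i := by
  simp [PP, gzQ_coeff]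

lemma PP_eval {m : ℕ} (lam t : Fin (m+1) → ℝ) (i : Fin (m+1)) :
    (PP lam t).eval (lam i) = t i * ∏ k, (lam i - lam (i.succAbove k)) := by
  simp only [PP, eval_finsetSum, eval_mul, eval_C, gzQ_eval]
  refine Finset.sum_eq_single i (fun b _ hb => ?_) (by simp)
  obtain ⟨k, hk⟩ := Fin.exists_succAbove_eq hb.symm
  rw [Finset.prod_eq_zero (Finset.mem_univ k) (by rw [hk]; simp), mul_zero]

lemma Psi_sum {m : ℕ} {lam : Fin (m+1) → ℝ} (hlam : Function.Injective lam) (v : Fin (m+1) → ℝ) :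
    ∑ i, Psi lam v i = v 0 := by
  have : PP lam (Psi lam v) = C (v 0) * gzQ (fun k => v k.succ) := by
    refine poly_eq hlam (PP_degree _ _) ?_ fun i => ?_
    · exact degree_C_mul_gzQ _ _
    · rw [PP_eval, Psi, eval_mul, eval_C, gzQ_eval]
      have := d_ne hlam i
      field_simp
  rw [← PP_coeff lam, this]
  simp [gzQ_coeff]

lemma Psi_pos {m : ℕ} {lam : Fin (m+1) → ℝ} (hlam : StrictAnti lam) {v : Fin (m+1) → ℝ}
    (h0 : 0 < v 0) (hv : (fun k : Fin m => v k.succ) ∈ inter lam) (i : Fin (m+1)) :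
    0 < Psi lam v i := by
  rw [Psi, ← Finset.prod_div_distrib]
  refine mul_pos h0 (Finset.prod_pos fun k _ => ?_)
  have hk := hv k (Set.mem_univ _)
  simp only [Set.mem_Ioo] at hk
  rcases lt_or_ge k.castSucc i with h | h
  · rw [Fin.succAbove_of_castSucc_lt _ _ h]
    have h1 := hlam h
    have h2 : lam i ≤ lam k.succ := hlam.antitone (Fin.castSucc_lt_iff_succ_le.1 h)
    exact div_pos_of_neg_of_neg (by linarith) (by linarith)
  · rw [Fin.succAbove_of_le_castSucc _ _ h]
    have h1 : lam k.castSucc ≤ lam i := hlam.antitone h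
    exact div_pos (by linarith) (by linarith)

lemma d_sign {m : ℕ} {lam : Fin (m+1) → ℝ} (hlam : StrictAnti lam) (i : Fin (m+1)) :
    0 < (-1 : ℝ) ^ (i : ℕ) * ∏ k, (lam i - lam (i.succAbove k)) := by
  have h1 : ∏ k : Fin m, (if k.castSucc < i then (-1 : ℝ) else 1) = (-1) ^ (i : ℕ) := by
    rw [Finset.prod_ite, Finset.prod_const, Finset.prod_const_one, mul_one]
    congr 1
    have : (Finset.univ.filter fun k : Fin m => k.castSucc < i)
      = (Finset.univ.filter fun k : Fin m => (k : ℕ) < i) := by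
        ext k; simp [Fin.lt_def]
    rw [this, Fin.card_filter_val_lt]
    omega
  rw [← h1, ← Finset.prod_mul_distrib]
  refine Finset.prod_pos fun k _ => ?_
  split_ifs with h
  · rw [Fin.succAbove_of_castSucc_lt _ _ h]
    have := hlam h
    linarith
  · rw [Fin.succAbove_of_le_castSucc _ _ (not_lt.1 h)]
    have h1 : i < k.succ := Fin.le_castSucc_iff.1 (not_lt.1 h)
    have := hlam h1
    linarith

lemma Psi_surj {m : ℕ} {lam : Fin (m+1) → ℝ} (hlam : StrictAnti lam) {t : Fin (m+1) → ℝ}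
    (ht : ∀ i, 0 < t i) : ∃ mu ∈ inter lam, Psi lam (Fin.cons (∑ i, t i) mu) = t := by
  have hroot : ∀ k : Fin m, ∃ x ∈ Set.Ioo (lam k.succ) (lam k.castSucc),
      (PP lam t).eval x = 0 := by
    intro k
    have hle : lam k.succ ≤ lam k.castSucc := hlam.antitone (Fin.castSucc_lt_succ).le
    have hc : ContinuousOn (fun x => (PP lam t).eval x) (Set.Icc (lam k.succ) (lam k.castSucc)) :=
      (PP lam t).continuous.continuousOn
    have s1 := mul_pos (ht k.succ) (d_sign hlam k.succ)
    have s2 := mul_pos (ht k.castSucc) (d_sign hlam k.castSucc)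
    have e1 := PP_eval lam t k.succ
    have e2 := PP_eval lam t k.castSucc
    rw [mul_left_comm, ← e1] at s1
    rw [mul_left_comm, ← e2] at s2
    simp only [Fin.val_succ, Fin.val_castSucc, pow_succ] at s1 s2
    rcases neg_one_pow_eq_or ℝ (k : ℕ) with h | h
    · rw [h] at s1 s2
      obtain ⟨x, hx, hx0⟩ := intermediate_value_Ioo hle hc
        (show (0 : ℝ) ∈ _ from ⟨by linarith, by linarith⟩)
      exact ⟨x, hx, hx0⟩
    · rw [h] at s1 s2
      obtain ⟨x, hx, hx0⟩ := intermediate_value_Ioo' hle hc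
        (show (0 : ℝ) ∈ _ from ⟨by linarith, by linarith⟩)
      exact ⟨x, hx, hx0⟩
  choose mu hmu hmu0 using hroot
  have hin : mu ∈ inter lam := fun k _ => hmu k
  have hanti := inter_strictAnti hlam hin
  refine ⟨mu, hin, ?_⟩
  have hpoly : PP lam t = C (∑ i, t i) * gzQ mu := by
    rw [← sub_eq_zero]
    refine eq_zero_of_degree_lt_of_eval_index_eq_zero (Finset.univ : Finset (Fin m))
      (v := mu) hanti.injective.injOn ?_ ?_
    · rw [Finset.card_univ, Fintype.card_fin]
      rw [degree_lt_iff_coeff_zero]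
      intro j hj
      rcases hj.lt_or_eq with hj | hj
      · have a1 : (PP lam t).coeff j = 0 := coeff_eq_zero_of_degree_lt
          (lt_of_le_of_lt (PP_degree _ _) (by exact_mod_cast hj))
        have a2 : (gzQ mu).coeff j = 0 := coeff_eq_zero_of_degree_lt
          (lt_of_le_of_lt (gzQ_degree mu).le (by exact_mod_cast hj))
        rw [coeff_sub, coeff_C_mul, a1, a2]; simp
      · subst hj
        rw [coeff_sub, coeff_C_mul, PP_coeff, gzQ_coeff]; simp
    · intro k _
      rw [eval_sub, hmu0, eval_mul, gzQ_eval, Finset.prod_eq_zero (Finset.mem_univ k) (by simp)]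
      simp
  funext i
  have := PP_eval lam t i
  rw [hpoly, eval_mul, eval_C, gzQ_eval] at this
  simp only [Psi, Fin.cons_zero, Fin.cons_succ]
  rw [← mul_div_assoc, this, mul_div_assoc, div_self (d_ne hlam.injective i), mul_one]

lemma Psi_cons_inj {m : ℕ} {lam : Fin (m+1) → ℝ} (hlam : StrictAnti lam) {s s' : ℝ}
    {mu nu : Fin m → ℝ} (hmu : Antitone mu) (hnu : Antitone nu) (hs : s ≠ 0)
    (h : Psi lam (Fin.cons s mu) = Psi lam (Fin.cons s' nu)) : s = s' ∧ mu = nu := by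
  refine smul_gzQ_inj hlam.injective hmu hnu hs fun i => ?_
  have := congrFun h i
  simp only [Psi, Fin.cons_zero, Fin.cons_succ, ← mul_div_assoc] at this
  exact (div_left_inj' (d_ne hlam.injective i)).1 this

end GZ

namespace GZ
open Polynomial

/-- absolute value of the Vandermonde determinant -/
noncomputable def vd {m : ℕ} (a : Fin m → ℝ) : ℝ := |(Matrix.vandermonde a).det|

lemma vd_pos {m : ℕ} {a : Fin m → ℝ} (h : Function.Injective a) : 0 < vd a :=
  abs_pos.2 (Matrix.det_vandermonde_ne_zero_iff.2 h)

lemma vd_continuous {m : ℕ} : Continuous (vd : (Fin m → ℝ) → ℝ) := by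
  unfold vd
  simp only [Matrix.det_vandermonde]
  fun_prop

lemma offdiag {m : ℕ} (a : Fin m → ℝ) :
    ∏ i, ∏ j ∈ Finset.univ.erase i, |a i - a j| = vd a ^ 2 := by
  have h := Finset.prod_prod_Ioi_mul_eq_prod_prod_off_diag (fun i j : Fin m => |a j - a i|)
  have e : ∀ i : Fin m, Finset.univ.erase i = {i}ᶜ := fun i => by ext; simp
  simp only [e]
  rw [← h, vd, Matrix.det_vandermonde, Finset.abs_prod, sq, ← Finset.prod_mul_distrib]
  refine Finset.prod_congr rfl fun i _ => ?_
  rw [Finset.abs_prod, ← Finset.prod_mul_distrib]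
  refine Finset.prod_congr rfl fun j _ => ?_
  rw [abs_sub_comm (a i) (a j)]

lemma prod_succAbove_eq {m : ℕ} (i : Fin (m+1)) (f : Fin (m+1) → ℝ) :
    ∏ k, f (i.succAbove k) = ∏ j ∈ Finset.univ.erase i, f j := by
  rw [← Finset.prod_image (s := Finset.univ) (g := i.succAbove) (f := f)
    (Fin.succAbove_right_injective.injOn)]
  congr 1
  ext j
  simp

lemma prod_d {m : ℕ} (lam : Fin (m+1) → ℝ) :
    ∏ i, |∏ k, (lam i - lam (i.succAbove k))| = vd lam ^ 2 := by
  rw [← offdiag]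
  refine Finset.prod_congr rfl fun i _ => ?_
  rw [prod_succAbove_eq i (fun j => lam i - lam j), Finset.abs_prod]

/-- the polynomials in the derivative -/
noncomputable def pj {m : ℕ} (mu : Fin m → ℝ) : Fin (m+1) → ℝ[X] :=
  Fin.cons (gzQ mu) (fun k => ∏ l ∈ Finset.univ.erase k, (X - C (mu l)))

/-- evaluation matrix -/
noncomputable def MM {m : ℕ} (x : Fin (m+1) → ℝ) (mu : Fin m → ℝ) :
    Matrix (Fin (m+1)) (Fin (m+1)) ℝ := Matrix.of fun i j => (pj mu j).eval (x i)

/-- coefficient matrix -/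
noncomputable def CC {m : ℕ} (mu : Fin m → ℝ) :
    Matrix (Fin (m+1)) (Fin (m+1)) ℝ := Matrix.of fun a j => (pj mu j).coeff a

lemma MM_eq {m : ℕ} (x : Fin (m+1) → ℝ) (mu : Fin m → ℝ) :
    MM x mu = Matrix.vandermonde x * CC mu := by
  ext i j
  have hd : (pj mu j).natDegree < m + 1 := by
    refine Fin.cases ?_ (fun k => ?_) j
    · simp [pj, gzQ_natDegree]
    · simp only [pj, Fin.cons_succ, natDegree_finsetProd_X_sub_C_eq_card]
      have := Finset.card_le_univ (Finset.univ.erase k)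
      simp only [Fintype.card_fin] at this
      omega
  rw [MM, Matrix.of_apply, eval_eq_sum_range' hd, Finset.sum_range, Matrix.mul_apply]
  refine Finset.sum_congr rfl fun a _ => ?_
  rw [Matrix.vandermonde_apply, CC, Matrix.of_apply, mul_comm]

lemma MM_cons_det {m : ℕ} (y : ℝ) (mu : Fin m → ℝ) :
    (MM (Fin.cons y mu) mu).det =
      (∏ k, (y - mu k)) * ∏ k, ∏ l ∈ Finset.univ.erase k, (mu k - mu l) := by
  rw [Matrix.det_of_isUpperTriangular]
  · rw [Fin.prod_univ_succ]
    simp [MM, pj, gzQ_eval, eval_prod]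
  · intro i j hij
    revert hij
    refine Fin.cases (fun h => by simp at h) (fun i' => ?_) i
    refine Fin.cases (fun _ => ?_) (fun j' h => ?_) j
    · simp only [MM, pj, Matrix.of_apply, Fin.cons_zero, Fin.cons_succ, gzQ_eval]
      exact Finset.prod_eq_zero (Finset.mem_univ i') (sub_self _)
    · simp only [MM, pj, Matrix.of_apply, Fin.cons_succ, eval_prod]
      have hne : i' ≠ j' := by
        rintro rfl; simp at h
      exact Finset.prod_eq_zero (i := i') (by simp [hne]) (by simp)

lemma CC_det {m : ℕ} {mu : Fin m → ℝ} (hmu : Function.Injective mu) :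
    |(CC mu).det| = vd mu := by
  obtain ⟨y, hy⟩ : ∃ y : ℝ, y ∉ Set.range mu :=
    (Set.finite_range mu).infinite_compl.nonempty
  have h := congrArg abs (MM_cons_det y mu)
  rw [MM_eq, Matrix.det_mul, abs_mul, abs_mul, Matrix.det_vandermonde, Fin.prod_univ_succ] at h
  simp only [Fin.prod_Ioi_zero, Fin.prod_Ioi_succ, Fin.cons_zero, Fin.cons_succ] at h
  rw [← Matrix.det_vandermonde, abs_mul] at h
  have e : |∏ k, (mu k - y)| = |∏ k, (y - mu k)| := by
    rw [Finset.abs_prod, Finset.abs_prod]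
    exact Finset.prod_congr rfl fun k _ => abs_sub_comm _ _
  have e2 : |∏ k, ∏ l ∈ Finset.univ.erase k, (mu k - mu l)| = vd mu ^ 2 := by
    rw [← offdiag, Finset.abs_prod]
    exact Finset.prod_congr rfl fun k _ => Finset.abs_prod _ _
  rw [e, e2, mul_assoc] at h
  have hne : |∏ k, (y - mu k)| ≠ 0 := abs_ne_zero.2 <|
    Finset.prod_ne_zero_iff.2 fun k _ => sub_ne_zero.2 fun h => hy ⟨k, h.symm⟩
  have h2 := mul_left_cancel₀ hne h
  have hv := vd_pos hmu
  change vd mu * _ = _ at h2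
  rw [sq] at h2
  exact mul_left_cancel₀ hv.ne' h2

lemma MM_det {m : ℕ} (x : Fin (m+1) → ℝ) {mu : Fin m → ℝ} (hmu : Function.Injective mu) :
    |(MM x mu).det| = vd x * vd mu := by
  rw [MM_eq, Matrix.det_mul, abs_mul, CC_det hmu]
  rfl

/-- Jacobian matrix of `Psi`. -/
noncomputable def JJ {m : ℕ} (lam v : Fin (m+1) → ℝ) : Matrix (Fin (m+1)) (Fin (m+1)) ℝ :=
  Matrix.diagonal (fun i => (∏ k, (lam i - lam (i.succAbove k)))⁻¹) *
    MM lam (fun k => v k.succ) * Matrix.diagonal (Fin.cons 1 (fun _ => - v 0))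

lemma JJ_det {m : ℕ} {lam v : Fin (m+1) → ℝ} (hlam : Function.Injective lam)
    (hv : Function.Injective (fun k : Fin m => v k.succ)) :
    |(JJ lam v).det| = |v 0| ^ m * vd (fun k : Fin m => v k.succ) / vd lam := by
  have e1 : |∏ i, (∏ k, (lam i - lam (i.succAbove k)))⁻¹| = (vd lam ^ 2)⁻¹ := by
    rw [← prod_d, Finset.abs_prod, ← Finset.prod_inv_distrib]
    exact Finset.prod_congr rfl fun i _ => abs_inv _
  have e2 : |∏ i : Fin (m+1), (Fin.cons 1 (fun _ => - v 0) : Fin (m+1) → ℝ) i| = |v 0| ^ m := by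
    rw [Fin.prod_univ_succ]
    simp [abs_pow]
  rw [JJ, Matrix.det_mul, Matrix.det_mul, abs_mul, abs_mul, MM_det _ hv, Matrix.det_diagonal,
    Matrix.det_diagonal, e1, e2]
  have := vd_pos hlam
  field_simp

lemma JJ_mulVec {m : ℕ} (lam v w : Fin (m+1) → ℝ) (i : Fin (m+1)) :
    (JJ lam v).mulVec w i = (∏ k, (lam i - lam (i.succAbove k)))⁻¹ *
      (w 0 * (∏ k : Fin m, (lam i - v k.succ)) -
        v 0 * ∑ k : Fin m, (∏ l ∈ Finset.univ.erase k, (lam i - v l.succ)) * w k.succ) := by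
  rw [JJ, Matrix.mulVec, dotProduct, Fin.sum_univ_succ]
  simp only [Matrix.mul_diagonal, Matrix.diagonal_mul, MM, pj, Matrix.of_apply, Fin.cons_zero,
    Fin.cons_succ, gzQ_eval, eval_prod, eval_sub, eval_X, eval_C]
  rw [mul_sub, sub_eq_add_neg, Finset.mul_sum, Finset.mul_sum, ← Finset.sum_neg_distrib]
  congr 1
  · ring
  · exact Finset.sum_congr rfl fun k _ => by ring

/-- derivative of `Psi`. -/
noncomputable def JL {m : ℕ} (lam v : Fin (m+1) → ℝ) : (Fin (m+1) → ℝ) →L[ℝ] (Fin (m+1) → ℝ) :=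
  LinearMap.toContinuousLinearMap (Matrix.toLin' (JJ lam v))

lemma JL_det {m : ℕ} (lam v : Fin (m+1) → ℝ) : (JL lam v).det = (JJ lam v).det := by
  simp [JL, LinearMap.det_toContinuousLinearMap]

lemma Psi_hasFDerivAt {m : ℕ} (lam v : Fin (m+1) → ℝ) : HasFDerivAt (Psi lam) (JL lam v) v := by
  rw [hasFDerivAt_pi']
  intro i
  have hp : ∀ j : Fin (m+1), HasFDerivAt (fun v : Fin (m+1) → ℝ => v j)
      (ContinuousLinearMap.proj (R := ℝ) (φ := fun _ => ℝ) j) v := fun j =>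
    (ContinuousLinearMap.proj (R := ℝ) (φ := fun _ => ℝ) j).hasFDerivAt
  have h1 : ∀ k ∈ (Finset.univ : Finset (Fin m)), HasFDerivAt
      (fun v : Fin (m+1) → ℝ => lam i - v k.succ)
      (-(ContinuousLinearMap.proj (R := ℝ) (φ := fun _ => ℝ) k.succ)) v :=
    fun k _ => (hp k.succ).const_sub (lam i)
  have h2 := (hp 0).mul ((HasFDerivAt.finsetProd h1).mul_const
    (∏ k, (lam i - lam (i.succAbove k)))⁻¹)
  refine h2.congr_fderiv ?_
  ext w
  simp only [ContinuousLinearMap.comp_apply, JL, LinearMap.coe_toContinuousLinearMap',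
    Matrix.toLin'_apply, ContinuousLinearMap.proj_apply, JJ_mulVec]
  simp only [_root_.add_apply, _root_.smul_apply,
    ContinuousLinearMap.proj_apply, _root_.sum_apply, _root_.neg_apply, smul_eq_mul, mul_neg, Finset.sum_neg_distrib]
  ring

end GZ

namespace GZ
open MeasureTheory Set
open scoped ENNReal

lemma inter_measurable {m : ℕ} (lam : Fin (m+1) → ℝ) : MeasurableSet (inter lam) :=
  MeasurableSet.univ_pi fun _ => measurableSet_Ioo

lemma Psi_continuous {m : ℕ} (lam : Fin (m+1) → ℝ) : Continuous (Psi lam) := by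
  unfold Psi
  fun_prop

lemma Psi_cons_continuous {m : ℕ} (lam : Fin (m+1) → ℝ) :
    Continuous (fun mu : Fin m → ℝ => Psi lam (Fin.cons 1 mu)) := by
  unfold Psi
  simp only [Fin.cons_zero, Fin.cons_succ]
  fun_prop

lemma vd_measurable {m : ℕ} : Measurable (vd : (Fin m → ℝ) → ℝ) := vd_continuous.measurable

/-- radial constant -/
noncomputable def K2 (m : ℕ) : ℝ≥0∞ :=
  ∫⁻ s in Ioi (0:ℝ), ENNReal.ofReal (s ^ m) * (Iio (1:ℝ)).indicator 1 s

lemma cov {m : ℕ} {lam : Fin (m+1) → ℝ} (hlam : StrictAnti lam)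
    {g : (Fin (m+1) → ℝ) → ℝ≥0∞} (hg : Measurable g) :
    ∫⁻ t in Set.pi univ (fun _ : Fin (m+1) => Ioi (0:ℝ)),
      (Iio (1:ℝ)).indicator 1 (∑ i, t i) * g ((∑ i, t i)⁻¹ • t) =
    K2 m * ((ENNReal.ofReal (vd lam))⁻¹ *
      ∫⁻ mu in inter lam, ENNReal.ofReal (vd mu) * g (Psi lam (Fin.cons 1 mu))) := by
  set e := MeasurableEquiv.piFinSuccAbove (fun _ : Fin (m+1) => ℝ) 0 with he
  have hpres : MeasurePreserving e volume volume :=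
    volume_preserving_piFinSuccAbove (fun _ : Fin (m+1) => ℝ) 0
  have e1 : ∀ v, (e v).1 = v 0 := fun v => rfl
  have e2 : ∀ v, (e v).2 = fun k : Fin m => v k.succ := fun v => by
    funext k; simp [he, MeasurableEquiv.piFinSuccAbove, Fin.insertNthEquiv, Fin.tail]
  set S : Set (Fin (m+1) → ℝ) := e ⁻¹' (Ioi 0 ×ˢ inter lam) with hS
  have hSm : MeasurableSet S := e.measurable (measurableSet_Ioi.prod (inter_measurable lam))
  have memS : ∀ v, v ∈ S ↔ 0 < v 0 ∧ (fun k : Fin m => v k.succ) ∈ inter lam := fun v => by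
    rw [hS, mem_preimage, mem_prod, e1, e2]; rfl
  have consv : ∀ v : Fin (m+1) → ℝ, Fin.cons (v 0) (fun k : Fin m => v k.succ) = v := fun v =>
    Fin.cons_self_tail v
  have himg : Psi lam '' S = Set.pi univ (fun _ : Fin (m+1) => Ioi (0:ℝ)) := by
    ext t
    constructor
    · rintro ⟨v, hv, rfl⟩ i _
      exact Psi_pos hlam ((memS v).1 hv).1 ((memS v).1 hv).2 i
    · intro ht
      obtain ⟨mu, hmu, h⟩ := Psi_surj hlam (fun i => ht i (mem_univ i))
      refine ⟨_, (memS _).2 ⟨?_, ?_⟩, h⟩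
      · rw [Fin.cons_zero]
        exact Finset.sum_pos (fun i _ => ht i (mem_univ i)) Finset.univ_nonempty
      · simpa only [Fin.cons_succ] using hmu
  have hinj : InjOn (Psi lam) S := by
    intro v hv w hw h
    obtain ⟨hv0, hv1⟩ := (memS v).1 hv
    obtain ⟨hw0, hw1⟩ := (memS w).1 hw
    rw [← consv v, ← consv w] at h
    obtain ⟨a, b⟩ := Psi_cons_inj hlam (inter_strictAnti hlam hv1).antitone
      (inter_strictAnti hlam hw1).antitone hv0.ne' h
    rw [← consv v, ← consv w, a, b]
  rw [← himg, lintegral_image_eq_lintegral_abs_det_fderiv_mul volume hSm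
    (fun v _ => (Psi_hasFDerivAt lam v).hasFDerivWithinAt) hinj]
  set F : ℝ × (Fin m → ℝ) → ℝ≥0∞ := fun p =>
    (ENNReal.ofReal (p.1 ^ m) * (Iio (1:ℝ)).indicator 1 p.1) *
    ((ENNReal.ofReal (vd lam))⁻¹ * (ENNReal.ofReal (vd p.2) * g (Psi lam (Fin.cons 1 p.2)))) with hF
  have step : ∫⁻ v in S, ENNReal.ofReal |(JL lam v).det| *
      ((Iio (1:ℝ)).indicator 1 (∑ i, Psi lam v i) * g ((∑ i, Psi lam v i)⁻¹ • Psi lam v)) =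
      ∫⁻ v in S, F (e v) := by
    refine setLIntegral_congr_fun hSm fun v hv => ?_
    obtain ⟨hv0, hv1⟩ := (memS v).1 hv
    have hvl := vd_pos hlam.injective
    have hsm : (v 0)⁻¹ • Psi lam v = Psi lam (Fin.cons 1 (fun k : Fin m => v k.succ)) := by
      funext i
      simp only [Psi, Pi.smul_apply, smul_eq_mul, Fin.cons_zero, Fin.cons_succ]
      rw [← mul_assoc, inv_mul_cancel₀ hv0.ne']
    simp only [hF, e1, e2]
    rw [Psi_sum hlam.injective, hsm, JL_det,
      JJ_det hlam.injective (inter_strictAnti hlam hv1).injective, abs_of_pos hv0,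
      ENNReal.ofReal_div_of_pos hvl, ENNReal.ofReal_mul (by positivity), div_eq_mul_inv]
    ring
  rw [step, hS, hpres.setLIntegral_comp_preimage_emb e.measurableEmbedding, Measure.volume_eq_prod,
    ← Measure.prod_restrict]
  simp only [hF]
  rw [lintegral_prod_mul (f := fun s : ℝ => ENNReal.ofReal (s ^ m) * (Iio (1:ℝ)).indicator 1 s)
    (g := fun mu => (ENNReal.ofReal (vd lam))⁻¹ *
      (ENNReal.ofReal (vd mu) * g (Psi lam (Fin.cons 1 mu)))), lintegral_const_mul, K2]
  · exact (vd_measurable.ennreal_ofReal).mul (hg.comp (Psi_cons_continuous lam).measurable)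
  · refine Measurable.aemeasurable ?_
    exact (by fun_prop : Measurable fun s : ℝ => ENNReal.ofReal (s ^ m)).mul
      (measurable_one.indicator measurableSet_Iio)
  · exact ((vd_measurable.ennreal_ofReal).mul
      (hg.comp (Psi_cons_continuous lam).measurable)).const_mul _ |>.aemeasurable

lemma K2_ne_top (m : ℕ) : K2 m ≠ ∞ := by
  have : K2 m ≤ ∫⁻ s in Ioi (0:ℝ), (Iio (1:ℝ)).indicator 1 s := by
    refine setLIntegral_mono (measurable_one.indicator measurableSet_Iio) fun s hs => ?_
    by_cases h : s < 1
    · rw [indicator_of_mem (show s ∈ Iio (1:ℝ) from h)]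
      simp only [Pi.one_apply, mul_one]
      exact ENNReal.ofReal_le_one.2 (pow_le_one₀ (le_of_lt hs) h.le)
    · rw [indicator_of_notMem (show s ∉ Iio (1:ℝ) from h)]; simp
  refine ne_top_of_le_ne_top ?_ this
  rw [lintegral_indicator_one measurableSet_Iio, Measure.restrict_apply measurableSet_Iio]
  have : Iio (1:ℝ) ∩ Ioi 0 = Ioo 0 1 := by ext; simp [and_comm]
  rw [this]; simp

lemma K2_ne_zero (m : ℕ) : K2 m ≠ 0 := by
  rw [K2, Ne, lintegral_eq_zero_iff]
  · intro h
    have h2 : ∀ᵐ s ∂(volume.restrict (Ioi (0:ℝ))), ¬ (s < 1) := by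
      filter_upwards [h, ae_restrict_mem measurableSet_Ioi] with s hs hs0 hlt
      simp only [Pi.zero_apply, mul_eq_zero, indicator_of_mem (show s ∈ Iio (1:ℝ) from hlt)] at hs
      rcases hs with hs | hs
      · rw [ENNReal.ofReal_eq_zero] at hs
        exact absurd (pow_pos (show 0 < s from hs0) m) (not_lt.2 hs)
      · simp at hs
    rw [ae_iff] at h2
    simp only [not_not] at h2
    rw [Measure.restrict_apply (show MeasurableSet {a : ℝ | a < 1} from measurableSet_Iio)] at h2
    have : {a : ℝ | a < 1} ∩ Ioi 0 = Ioo 0 1 := by ext; simp [and_comm]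
    rw [this] at h2; simp at h2
  · exact (by fun_prop : Measurable fun s : ℝ => ENNReal.ofReal (s ^ m)).mul
      (measurable_one.indicator measurableSet_Iio)

end GZ

namespace GZ
open MeasureTheory Set
open scoped ENNReal Matrix

lemma preserving_normSq :
    MeasurePreserving (fun z : ℂ => Real.pi * ‖z‖ ^ 2) volume (volume.restrict (Ioi (0:ℝ))) := by
  have hm : Measurable (fun z : ℂ => Real.pi * ‖z‖ ^ 2) := by fun_prop
  refine ⟨hm, ?_⟩
  refine Measure.ext_of_lintegral _ fun g hg => ?_
  rw [lintegral_map hg hm, ← Complex.lintegral_comp_polarCoord_symm]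
  have himg : (fun r : ℝ => Real.pi * r ^ 2) '' Ioi 0 = Ioi 0 := by
    ext t
    constructor
    · rintro ⟨r, hr, rfl⟩
      have : 0 < r := hr
      have := Real.pi_pos
      simp only [mem_Ioi]; positivity
    · intro ht
      have ht : 0 < t := ht
      have := Real.pi_pos
      refine ⟨Real.sqrt (t / Real.pi), Real.sqrt_pos.2 (by positivity), ?_⟩
      simp only
      rw [Real.sq_sqrt (by positivity)]
      field_simp
  have hinj : InjOn (fun r : ℝ => Real.pi * r ^ 2) (Ioi 0) := by
    intro a ha b hb h
    have := mul_left_cancel₀ Real.pi_pos.ne' h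
    exact (pow_left_inj₀ (le_of_lt ha) (le_of_lt hb) two_ne_zero).1 this
  have hd : ∀ r ∈ Ioi (0:ℝ), HasDerivWithinAt (fun r : ℝ => Real.pi * r ^ 2)
      (Real.pi * (2 * r)) (Ioi 0) r := by
    intro r _
    have := ((hasDerivAt_pow 2 r).const_mul Real.pi).hasDerivWithinAt (s := Ioi 0)
    simpa using this
  conv_rhs => rw [← himg]
  rw [lintegral_image_eq_lintegral_abs_deriv_mul measurableSet_Ioi hd hinj]
  rw [polarCoord_target, Measure.volume_eq_prod, ← Measure.prod_restrict]
  have e : ∀ p : ℝ × ℝ, ENNReal.ofReal p.1 • g (Real.pi * ‖Complex.polarCoord.symm p‖ ^ 2) =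
     (ENNReal.ofReal p.1 * g (Real.pi * p.1 ^ 2)) * 1 := by
    intro p
    rw [mul_one, smul_eq_mul, Complex.norm_polarCoord_symm, sq_abs]
  simp only [e]
  rw [lintegral_prod_mul (f := fun r => ENNReal.ofReal r * g (Real.pi * r ^ 2))
    (g := fun _ => 1) (by fun_prop) (by fun_prop)]
  simp only [lintegral_const, one_mul, Measure.restrict_apply MeasurableSet.univ, univ_inter,
    Real.volume_Ioo]
  rw [← lintegral_mul_const _ (by fun_prop)]
  refine setLIntegral_congr_fun measurableSet_Ioi fun r hr => ?_
  have hr : 0 < r := hr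
  have hpi := Real.pi_pos
  rw [abs_of_pos (by positivity), show Real.pi - -Real.pi = 2 * Real.pi by ring,
    show Real.pi * (2 * r) = r * (2 * Real.pi) by ring, ENNReal.ofReal_mul hr.le]
  ring

lemma lintegral_normSq {n : ℕ} {G : (Fin n → ℝ) → ℝ≥0∞} (hG : Measurable G) :
    ∫⁻ z : Fin n → ℂ, G (fun i => Real.pi * ‖z i‖ ^ 2) =
      ∫⁻ t in Set.pi univ (fun _ : Fin n => Ioi (0:ℝ)), G t := by
  have := measurePreserving_pi (fun _ : Fin n => (volume : Measure ℂ))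
    (fun _ : Fin n => volume.restrict (Ioi (0:ℝ))) (fun _ => preserving_normSq)
  rw [← Measure.restrict_pi_pi] at this
  exact this.lintegral_comp hG

lemma norm_vecMul {n : ℕ} (U : Matrix.unitaryGroup (Fin n) ℂ) (z : Fin n → ℂ) :
    ∑ i, ‖(z ᵥ* (U : Matrix (Fin n) (Fin n) ℂ)) i‖ ^ 2 = ∑ i, ‖z i‖ ^ 2 := by
  have key : ∀ y : Fin n → ℂ, ((∑ i, ‖y i‖ ^ 2 : ℝ) : ℂ) = y ⬝ᵥ star y := by
    intro y
    rw [dotProduct]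
    push_cast
    refine Finset.sum_congr rfl fun i _ => ?_
    rw [Pi.star_apply, RCLike.star_def, Complex.mul_conj, Complex.normSq_eq_norm_sq]
    push_cast; rfl
  have : ((∑ i, ‖(z ᵥ* (U : Matrix (Fin n) (Fin n) ℂ)) i‖ ^ 2 : ℝ) : ℂ)
      = ((∑ i, ‖z i‖ ^ 2 : ℝ) : ℂ) := by
    rw [key, key, Matrix.star_vecMul, ← Matrix.dotProduct_mulVec, Matrix.mulVec_mulVec]
    have h := Matrix.mem_unitaryGroup_iff.1 U.2
    rw [Matrix.star_eq_conjTranspose] at h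
    rw [h, Matrix.one_mulVec]
  exact_mod_cast this

lemma vecMul_preserving {n : ℕ} (U : Matrix.unitaryGroup (Fin n) ℂ) :
    MeasurePreserving (fun z : Fin n → ℂ => z ᵥ* (U : Matrix (Fin n) (Fin n) ℂ)) volume volume := by
  set f : (Fin n → ℂ) →ₗ[ℝ] (Fin n → ℂ) :=
    (Matrix.vecMulLinear (U : Matrix (Fin n) (Fin n) ℂ)).restrictScalars ℝ with hf
  have hfa : ∀ z, f z = z ᵥ* (U : Matrix (Fin n) (Fin n) ℂ) := fun z => rfl
  have hinj : Function.Injective f := by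
    rw [← LinearMap.ker_eq_bot, LinearMap.ker_eq_bot']
    intro z hz
    have := norm_vecMul U z
    rw [← hfa, hz] at this
    simp only [Pi.zero_apply, norm_zero, ne_eq, OfNat.ofNat_ne_zero, not_false_eq_true, zero_pow,
      Finset.sum_const_zero] at this
    have h2 := (Finset.sum_eq_zero_iff_of_nonneg (fun i _ => by positivity)).1 this.symm
    funext i
    simpa using h2 i (Finset.mem_univ i)
  have hdet : LinearMap.det f ≠ 0 :=
    (LinearEquiv.isUnit_det' (LinearEquiv.ofInjectiveEndo f hinj)).ne_zero
  have hmap := Measure.map_linearMap_addHaar_eq_smul_addHaar (volume : Measure (Fin n → ℂ)) hdet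
  have hmeas : Measurable f := f.continuous_of_finiteDimensional.measurable
  set B : Set (Fin n → ℂ) := {z | ∑ i, ‖z i‖ ^ 2 < 1} with hB
  have hBo : IsOpen B := isOpen_lt (by fun_prop) continuous_const
  have hB0 : volume B ≠ 0 := (hBo.measure_pos volume ⟨0, by simp [hB]⟩).ne'
  have hBt : volume B ≠ ∞ := by
    have : B ⊆ Metric.closedBall 0 1 := by
      intro z hz
      rw [mem_closedBall_zero_iff, pi_norm_le_iff_of_nonneg zero_le_one]
      intro i
      have h1 : ‖z i‖ ^ 2 ≤ ∑ i, ‖z i‖ ^ 2 :=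
        Finset.single_le_sum (f := fun i => ‖z i‖ ^ 2) (fun i _ => by positivity) (Finset.mem_univ i)
      have h2 : ∑ i, ‖z i‖ ^ 2 < 1 := hz
      nlinarith [norm_nonneg (z i)]
    exact ((measure_mono this).trans_lt (isCompact_closedBall _ _).measure_lt_top).ne
  have hpre : f ⁻¹' B = B := by
    ext z
    simp only [hB, mem_preimage, mem_ofPred_eq, hfa, norm_vecMul]
  have h1 := congrArg (fun ν => ν B) hmap
  simp only [Measure.smul_apply, smul_eq_mul] at h1
  rw [Measure.map_apply hmeas hBo.measurableSet, hpre] at h1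
  have h2 : ENNReal.ofReal |(LinearMap.det f)⁻¹| = 1 := by
    have : 1 * volume B = ENNReal.ofReal |(LinearMap.det f)⁻¹| * volume B := by rw [one_mul, ← h1]
    exact ((ENNReal.mul_left_inj hB0 hBt).1 this).symm
  rw [h2, one_smul] at hmap
  exact ⟨hmeas, hmap⟩

lemma exists_unitary_row {n : ℕ} (r : Fin n) (z : Fin n → ℂ) (hz : z ≠ 0) :
    ∃ W : Matrix.unitaryGroup (Fin n) ℂ, ∀ i,
      z i = (Real.sqrt (∑ i, ‖z i‖ ^ 2) : ℂ) * (W : Matrix (Fin n) (Fin n) ℂ) r i := by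
  set y : EuclideanSpace ℂ (Fin n) := WithLp.toLp 2 z with hy
  have hyn : ‖y‖ = Real.sqrt (∑ i, ‖z i‖ ^ 2) := by
    rw [EuclideanSpace.norm_eq]
  have hy0 : y ≠ 0 := by
    intro h; apply hz; funext i
    have := congrArg (fun w : EuclideanSpace ℂ (Fin n) => w i) h
    simpa [hy] using this
  have hyn0 : (‖y‖ : ℂ) ≠ 0 := by exact_mod_cast norm_ne_zero_iff.2 hy0
  obtain ⟨b, hb⟩ := Orthonormal.exists_orthonormalBasis_extension_of_card_eq (𝕜 := ℂ)
    (E := EuclideanSpace ℂ (Fin n)) (ι := Fin n) (by simp)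
    (v := fun _ => ((‖y‖ : ℂ)⁻¹) • y) (s := {r}) (by
      constructor
      · intro i
        simp [norm_smul, hy0]
      · intro i j hij
        exact absurd (Subsingleton.elim i j) hij)
  have hbr := hb r rfl
  refine ⟨⟨Matrix.of fun i j => b i j, ?_⟩, fun i => ?_⟩
  · rw [Matrix.mem_unitaryGroup_iff]
    ext i k
    have := orthonormal_iff_ite.1 b.orthonormal k i
    rw [Matrix.mul_apply, Matrix.one_apply]
    rw [PiLp.inner_apply] at this
    simp only [Matrix.star_apply, Matrix.of_apply]
    simp only [RCLike.inner_apply] at this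
    rw [show (if i = k then (1:ℂ) else 0) = if k = i then 1 else 0 by simp only [eq_comm], ← this]
    rfl
  · simp only [Matrix.of_apply, hbr]
    rw [← hyn]
    simp only [PiLp.smul_apply, smul_eq_mul]
    rw [mul_inv_cancel_left₀ hyn0]

lemma measurable_coe {n : ℕ} (i j : Fin n) :
    Measurable (fun U : Matrix.unitaryGroup (Fin n) ℂ => (U : Matrix (Fin n) (Fin n) ℂ) i j) :=
  (measurable_pi_apply j).comp ((measurable_pi_apply i).comp measurable_subtype_coe)

lemma measurable_of_entries {Ω : Type*} [MeasurableSpace Ω] {n : ℕ}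
    {f : Ω → Matrix (Fin n) (Fin n) ℂ} (h : ∀ i j, Measurable fun ω => f ω i j) : Measurable f :=
  measurable_pi_lambda _ fun i => measurable_pi_lambda _ fun j => h i j

lemma measurable_mul {n : ℕ} : Measurable
    (fun p : Matrix.unitaryGroup (Fin n) ℂ × Matrix.unitaryGroup (Fin n) ℂ => p.1 * p.2) := by
  refine Measurable.subtype_mk (measurable_of_entries fun i j => ?_)
  simp only [Matrix.mul_apply]
  exact Finset.measurable_sum _ fun k _ => ((measurable_coe i k).comp measurable_fst).mul
    ((measurable_coe k j).comp measurable_snd)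

lemma measurable_mul_left {n : ℕ} (g : Matrix.unitaryGroup (Fin n) ℂ) :
    Measurable (fun U => g * U) :=
  measurable_mul.comp (measurable_const.prodMk measurable_id)

lemma measurable_mul_right {n : ℕ} (g : Matrix.unitaryGroup (Fin n) ℂ) :
    Measurable (fun U => U * g) :=
  measurable_mul.comp (measurable_id.prodMk measurable_const)

/-- squared moduli of a row -/
noncomputable def roww {n : ℕ} (r : Fin n) (U : Matrix.unitaryGroup (Fin n) ℂ) : Fin n → ℝ :=
  fun i => ‖(U : Matrix (Fin n) (Fin n) ℂ) r i‖ ^ 2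

lemma roww_measurable {n : ℕ} (r : Fin n) : Measurable (roww r) :=
  measurable_pi_lambda _ fun i => ((measurable_coe r i).norm).pow_const 2

/-- radial constant -/
noncomputable def K1 (n : ℕ) : ℝ≥0∞ :=
  ∫⁻ z : Fin n → ℂ, (Iio (1:ℝ)).indicator 1 (∑ i, Real.pi * ‖z i‖ ^ 2)

lemma row_law {n : ℕ} (r : Fin n) (μH : Measure (Matrix.unitaryGroup (Fin n) ℂ))
    [IsProbabilityMeasure μH]
    (hinv : ∀ g : Matrix.unitaryGroup (Fin n) ℂ, Measure.map (fun U => g * U) μH = μH)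
    {g : (Fin n → ℝ) → ℝ≥0∞} (hg : Measurable g) :
    K1 n * ∫⁻ U, g (roww r U) ∂μH = ∫⁻ z : Fin n → ℂ,
      (Iio (1:ℝ)).indicator 1 (∑ i, Real.pi * ‖z i‖ ^ 2) *
        g ((∑ i, Real.pi * ‖z i‖ ^ 2)⁻¹ • fun i => Real.pi * ‖z i‖ ^ 2) := by
  set H : (Fin n → ℂ) → ℝ≥0∞ := fun z =>
      (Iio (1:ℝ)).indicator 1 (∑ i, Real.pi * ‖z i‖ ^ 2) *
        g ((∑ i, Real.pi * ‖z i‖ ^ 2)⁻¹ • fun i => Real.pi * ‖z i‖ ^ 2) with hH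
  have hind : Measurable (fun z : Fin n → ℂ =>
      (Iio (1:ℝ)).indicator (1 : ℝ → ℝ≥0∞) (∑ i, Real.pi * ‖z i‖ ^ 2)) :=
    (measurable_one.indicator measurableSet_Iio).comp (by fun_prop)
  have hHm : Measurable H := by
    refine hind.mul (hg.comp ?_)
    refine measurable_pi_lambda _ fun i => ?_
    simp only [Pi.smul_apply, smul_eq_mul]
    fun_prop
  have s1 : ∀ U : Matrix.unitaryGroup (Fin n) ℂ,
      ∫⁻ z, H (z ᵥ* (U : Matrix (Fin n) (Fin n) ℂ)) = ∫⁻ z, H z := fun U =>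
    (vecMul_preserving U).lintegral_comp hHm
  have hjoint : Measurable (fun p : Matrix.unitaryGroup (Fin n) ℂ × (Fin n → ℂ) =>
      p.2 ᵥ* (p.1 : Matrix (Fin n) (Fin n) ℂ)) := by
    refine measurable_pi_lambda _ fun i => ?_
    simp only [Matrix.vecMul, dotProduct]
    exact Finset.measurable_sum _ fun k _ => ((measurable_pi_apply k).comp measurable_snd).mul
      ((measurable_coe k i).comp measurable_fst)
  have s2 : ∫⁻ z, H z = ∫⁻ U, (∫⁻ z, H (z ᵥ* (U : Matrix (Fin n) (Fin n) ℂ))) ∂μH := by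
    simp only [s1, lintegral_const, measure_univ, mul_one]
  rw [s2, lintegral_lintegral_swap (f := fun (U : Matrix.unitaryGroup (Fin n) ℂ) (z : Fin n → ℂ) =>
    H (z ᵥ* (U : Matrix (Fin n) (Fin n) ℂ))) (hHm.comp hjoint).aemeasurable, K1, mul_comm,
    ← lintegral_const_mul _ hind]
  have hpos : 0 < n := Fin.pos r
  have hne : ∀ᵐ z : Fin n → ℂ, z ≠ 0 := by
    have : Nonempty (Fin n) := ⟨r⟩
    rw [ae_iff]; simp
  refine lintegral_congr_ae ?_
  filter_upwards [hne] with z hz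
  obtain ⟨W, hW⟩ := exists_unitary_row r z hz
  have hN : 0 < ∑ i, ‖z i‖ ^ 2 := by
    obtain ⟨i, hi⟩ := Function.ne_iff.1 hz
    refine Finset.sum_pos' (fun i _ => by positivity) ⟨i, Finset.mem_univ i, ?_⟩
    have : 0 < ‖z i‖ := norm_pos_iff.2 hi
    positivity
  have hrow : ∀ U : Matrix.unitaryGroup (Fin n) ℂ,
      H (z ᵥ* (U : Matrix (Fin n) (Fin n) ℂ)) =
      (Iio (1:ℝ)).indicator 1 (∑ i, Real.pi * ‖z i‖ ^ 2) * g (roww r (W * U)) := by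
    intro U
    simp only [hH, ← Finset.mul_sum, norm_vecMul]
    congr 2
    funext i
    have e : (z ᵥ* (U : Matrix (Fin n) (Fin n) ℂ)) i =
        (Real.sqrt (∑ i, ‖z i‖ ^ 2) : ℂ) * ((W * U : Matrix.unitaryGroup (Fin n) ℂ) :
          Matrix (Fin n) (Fin n) ℂ) r i := by
      rw [Matrix.UnitaryGroup.mul_val, Matrix.mul_apply, Finset.mul_sum, Matrix.vecMul, dotProduct]
      refine Finset.sum_congr rfl fun k _ => ?_
      rw [hW k, mul_assoc]
    simp only [Pi.smul_apply, smul_eq_mul, e, norm_mul, mul_pow, roww, Complex.norm_real,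
      Real.norm_eq_abs, sq_abs, Real.sq_sqrt hN.le]
    have := Real.pi_pos
    field_simp
  simp only [hrow]
  rw [lintegral_const_mul (f := fun x => g (roww r (W * x))) _ (hg.comp ((roww_measurable r).comp (measurable_mul_left W)))]
  rw [mul_comm]
  congr 1
  conv_lhs => rw [← hinv W]
  rw [lintegral_map (f := fun x => g (roww r x)) (hg.comp (roww_measurable r)) (measurable_mul_left W)]

lemma K1_eq (n : ℕ) : K1 n = volume (Set.pi univ (fun _ : Fin n => Ioi (0:ℝ)) ∩
    {t | ∑ i, t i < 1}) := by
  have hm : MeasurableSet {t : Fin n → ℝ | ∑ i, t i < 1} :=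
    measurableSet_lt (by fun_prop) measurable_const
  rw [K1, lintegral_normSq (G := fun t => (Iio (1:ℝ)).indicator 1 (∑ i, t i))
    ((measurable_one.indicator measurableSet_Iio).comp (by fun_prop))]
  rw [inter_comm, ← Measure.restrict_apply hm, ← lintegral_indicator_one hm]
  rfl

lemma K1_ne_zero (n : ℕ) : K1 n ≠ 0 := by
  rw [K1_eq]
  refine (IsOpen.measure_pos _ ?_ ?_).ne'
  · exact (isOpen_set_pi finite_univ fun _ _ => isOpen_Ioi).inter
      (isOpen_lt (by fun_prop) continuous_const)
  · refine ⟨fun _ => 1 / (n + 1 : ℝ), fun i _ => ?_, ?_⟩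
    · simp only [mem_Ioi]; positivity
    · simp only [mem_ofPred_eq, Finset.sum_const, Finset.card_univ, Fintype.card_fin, nsmul_eq_mul]
      rw [mul_one_div, div_lt_one (by positivity)]
      linarith

lemma K1_ne_top (n : ℕ) : K1 n ≠ ∞ := by
  rw [K1_eq]
  have : Set.pi univ (fun _ : Fin n => Ioi (0:ℝ)) ∩ {t | ∑ i, t i < 1} ⊆ Icc 0 1 := by
    rintro t ⟨h1, h2⟩
    have h1 : ∀ i, 0 < t i := fun i => h1 i (mem_univ i)
    have h2 : ∑ i, t i < 1 := h2
    refine ⟨fun i => (h1 i).le, fun i => ?_⟩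
    have := Finset.single_le_sum (f := t) (fun i _ => (h1 i).le) (Finset.mem_univ i)
    simp only [Pi.one_apply]; linarith
  exact ((measure_mono this).trans_lt isCompact_Icc.measure_lt_top).ne

/-- Law of the squared moduli of a row in terms of interlacing points. -/
lemma row_law_inter {m : ℕ} {lam : Fin (m+1) → ℝ} (hlam : StrictAnti lam) (r : Fin (m+1))
    (μH : Measure (Matrix.unitaryGroup (Fin (m+1)) ℂ)) [IsProbabilityMeasure μH]
    (hinv : ∀ g : Matrix.unitaryGroup (Fin (m+1)) ℂ, Measure.map (fun U => g * U) μH = μH)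
    {g : (Fin (m+1) → ℝ) → ℝ≥0∞} (hg : Measurable g) :
    K1 (m+1) * ∫⁻ U, g (roww r U) ∂μH = K2 m * ((ENNReal.ofReal (vd lam))⁻¹ *
      ∫⁻ mu in inter lam, ENNReal.ofReal (vd mu) * g (Psi lam (Fin.cons 1 mu))) := by
  rw [row_law r μH hinv hg, ← cov hlam hg,
    ← lintegral_normSq (G := fun t => (Iio (1:ℝ)).indicator 1 (∑ i, t i) * g ((∑ i, t i)⁻¹ • t))]
  refine ((measurable_one.indicator measurableSet_Iio).comp (by fun_prop)).mul (hg.comp ?_)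
  refine measurable_pi_lambda _ fun i => ?_
  simp only [Pi.smul_apply, smul_eq_mul]
  fun_prop

end GZ

namespace GZ
open MeasureTheory Set
open scoped ENNReal Matrix

lemma eigsDesc_antitone {n : ℕ} {A : Matrix (Fin n) (Fin n) ℂ} (hA : A.IsHermitian) :
    Antitone (eigsDesc hA) := by
  intro i j hij
  exact Tuple.monotone_sort hA.eigenvalues (Fin.rev_le_rev.2 hij)

lemma prod_eigsDesc {n : ℕ} {A : Matrix (Fin n) (Fin n) ℂ} (hA : A.IsHermitian) (x : ℝ) :
    ((∏ k, (x - eigsDesc hA k) : ℝ) : ℂ) = (Matrix.scalar (Fin n) (x : ℂ) - A).det := by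
  rw [← Matrix.eval_charpoly, hA.charpoly_eq, Polynomial.eval_prod]
  push_cast
  simp only [Polynomial.eval_sub, Polynomial.eval_X, Polynomial.eval_C]
  exact Fintype.prod_equiv (Fin.revPerm.trans (Tuple.sort hA.eigenvalues)) _ _ fun k => rfl

lemma eigsDesc_unique {n : ℕ} {A : Matrix (Fin n) (Fin n) ℂ} (hA : A.IsHermitian)
    {mu : Fin n → ℝ} (hmu : Antitone mu)
    (h : ∀ x : ℝ, ((∏ k, (x - mu k) : ℝ) : ℂ) = (Matrix.scalar (Fin n) (x : ℂ) - A).det) :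
    eigsDesc hA = mu := by
  refine evals_inj (x := fun i : Fin (n+1) => ((i : ℕ) : ℝ)) ?_ (eigsDesc_antitone hA) hmu
    fun i => ?_
  · intro a b hab
    have hab : ((a : ℕ) : ℝ) = ((b : ℕ) : ℝ) := hab
    exact Fin.ext (by exact_mod_cast hab)
  · have := (prod_eigsDesc hA ((i : ℕ) : ℝ)).trans (h _).symm
    exact_mod_cast this

lemma eigsDesc_congr {n : ℕ} {A B : Matrix (Fin n) (Fin n) ℂ} (h : A = B) (hA : A.IsHermitian)
    (hB : B.IsHermitian) : eigsDesc hA = eigsDesc hB := by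
  subst h; rfl

lemma det_scalar_conj {n : ℕ} (V : Matrix.unitaryGroup (Fin n) ℂ) (A : Matrix (Fin n) (Fin n) ℂ)
    (x : ℂ) : (Matrix.scalar (Fin n) x - (V : Matrix (Fin n) (Fin n) ℂ) * A *
      (V : Matrix (Fin n) (Fin n) ℂ)ᴴ).det = (Matrix.scalar (Fin n) x - A).det := by
  have h := Matrix.mem_unitaryGroup_iff.1 V.2
  rw [Matrix.star_eq_conjTranspose] at h
  have e : Matrix.scalar (Fin n) x - (V : Matrix (Fin n) (Fin n) ℂ) * A *
      (V : Matrix (Fin n) (Fin n) ℂ)ᴴ = (V : Matrix (Fin n) (Fin n) ℂ) *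
      (Matrix.scalar (Fin n) x - A) * (V : Matrix (Fin n) (Fin n) ℂ)ᴴ := by
    rw [mul_sub, sub_mul, ← (Matrix.scalar_commute x (fun r => mul_comm x r) _).eq,
      mul_assoc (Matrix.scalar (Fin n) x), h, mul_one]
  rw [e, Matrix.det_mul, Matrix.det_mul, mul_right_comm, ← Matrix.det_mul, h, Matrix.det_one,
    one_mul]

lemma eigsDesc_conj_diagonal {n : ℕ} (V : Matrix.unitaryGroup (Fin n) ℂ) {mu : Fin n → ℝ}
    (hmu : Antitone mu) : eigsDesc (conj_diagonal_isHermitian n mu V) = mu := by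
  refine eigsDesc_unique _ hmu fun x => ?_
  rw [det_scalar_conj, Matrix.scalar_apply, Matrix.diagonal_sub, Matrix.det_diagonal]
  push_cast; rfl

lemma eigsDesc_measurable {Ω : Type*} [MeasurableSpace Ω] {n : ℕ}
    {M : Ω → Matrix (Fin n) (Fin n) ℂ} (hM : Measurable M) (hH : ∀ ω, (M ω).IsHermitian) :
    Measurable (fun ω => eigsDesc (hH ω)) := by
  intro A hA
  have hanti : IsClosed {mu : Fin n → ℝ | Antitone mu} := by
    have : {mu : Fin n → ℝ | Antitone mu} = ⋂ i, ⋂ j, ⋂ (_ : i ≤ j), {mu | mu j ≤ mu i} := by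
      ext mu; simp [Antitone]
    rw [this]
    exact isClosed_iInter fun i => isClosed_iInter fun j => isClosed_iInter fun _ =>
      isClosed_le (continuous_apply j) (continuous_apply i)
  set E : (Fin n → ℝ) → (Fin (n+1) → ℝ) := fun mu i => ∏ k, (((i : ℕ) : ℝ) - mu k) with hE
  have hEc : Continuous E := by fun_prop
  have hEi : InjOn E {mu : Fin n → ℝ | Antitone mu} := by
    intro mu hmu nu hnu h
    refine evals_inj (x := fun i : Fin (n+1) => ((i : ℕ) : ℝ)) ?_ hmu hnu (fun i => congrFun h i)
    intro a b hab
    have hab : ((a : ℕ) : ℝ) = ((b : ℕ) : ℝ) := hab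
    exact Fin.ext (by exact_mod_cast hab)
  have hA' : MeasurableSet (A ∩ {mu : Fin n → ℝ | Antitone mu}) := hA.inter hanti.measurableSet
  have him : MeasurableSet (E '' (A ∩ {mu : Fin n → ℝ | Antitone mu})) :=
    hA'.image_of_continuousOn_injOn hEc.continuousOn (hEi.mono inter_subset_right)
  set D : Ω → (Fin (n+1) → ℝ) := fun ω i =>
    ((Matrix.scalar (Fin n) (((i : ℕ) : ℝ) : ℂ) - M ω).det).re with hD
  have hDm : Measurable D := by
    refine measurable_pi_lambda _ fun i => Complex.measurable_re.comp ?_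
    simp only [Matrix.det_apply]
    refine Finset.measurable_sum _ fun σ _ => Measurable.const_smul ?_ _
    refine Finset.measurable_prod _ fun k _ => ?_
    simp only [Matrix.sub_apply]
    exact measurable_const.sub ((measurable_pi_apply _).comp ((measurable_pi_apply _).comp hM))
  have hDE : ∀ ω, D ω = E (eigsDesc (hH ω)) := by
    intro ω
    funext i
    simp only [hD, hE]
    rw [← prod_eigsDesc (hH ω), Complex.ofReal_re]
  have : (fun ω => eigsDesc (hH ω)) ⁻¹' A = D ⁻¹' (E '' (A ∩ {mu : Fin n → ℝ | Antitone mu})) := by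
    ext ω
    simp only [mem_preimage, hDE]
    constructor
    · intro h
      exact ⟨_, ⟨h, eigsDesc_antitone _⟩, rfl⟩
    · rintro ⟨mu, ⟨h1, h2⟩, h3⟩
      rwa [← hEi h2 (eigsDesc_antitone _) h3]
  rw [this]
  exact hDm him

/-- eigenvalues of the minor of codimension one -/
noncomputable def minorEig {m : ℕ} (lam : Fin (m+1) → ℝ) (U : Matrix.unitaryGroup (Fin (m+1)) ℂ) :
    Fin m → ℝ :=
  eigsDesc ((conj_diagonal_isHermitian (m+1) lam U).submatrix (Fin.castLE (Nat.le_succ m)))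

lemma measurable_conj {Ω : Type*} [MeasurableSpace Ω] {n : ℕ}
    {U : Ω → Matrix.unitaryGroup (Fin n) ℂ} (hU : Measurable U)
    {A : Ω → Matrix (Fin n) (Fin n) ℂ} (hA : Measurable A) :
    Measurable (fun ω => (U ω : Matrix (Fin n) (Fin n) ℂ) * A ω *
      (U ω : Matrix (Fin n) (Fin n) ℂ)ᴴ) := by
  refine measurable_of_entries fun i j => ?_
  simp only [Matrix.mul_apply, Matrix.conjTranspose_apply]
  refine Finset.measurable_sum _ fun k _ => Measurable.mul ?_ ?_
  · refine Finset.measurable_sum _ fun l _ => Measurable.mul ((measurable_coe i l).comp hU) ?_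
    exact (measurable_pi_apply _).comp ((measurable_pi_apply _).comp hA)
  · exact Complex.continuous_conj.measurable.comp ((measurable_coe j k).comp hU)

lemma measurable_diag {n : ℕ} :
    Measurable (fun mu : Fin n → ℝ => Matrix.diagonal (fun i => (mu i : ℂ))) := by
  refine measurable_of_entries fun i j => ?_
  simp only [Matrix.diagonal_apply]
  by_cases h : i = j
  · simp only [h, if_true]
    exact Complex.measurable_ofReal.comp (measurable_pi_apply j)
  · simp only [h, if_false]
    exact measurable_const

lemma measurable_submatrix {n k : ℕ} (h : k ≤ n) :
    Measurable (fun A : Matrix (Fin n) (Fin n) ℂ => A.submatrix (Fin.castLE h) (Fin.castLE h)) :=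
  measurable_of_entries fun i j =>
    (measurable_pi_apply (Fin.castLE h j)).comp (measurable_pi_apply (Fin.castLE h i))

lemma minorEig_measurable {m : ℕ} (lam : Fin (m+1) → ℝ) : Measurable (minorEig lam) :=
  eigsDesc_measurable ((measurable_submatrix _).comp (measurable_conj measurable_id measurable_const)) _

lemma minor_det {m : ℕ} (lam : Fin (m+1) → ℝ) (U : Matrix.unitaryGroup (Fin (m+1)) ℂ)
    (i : Fin (m+1)) :
    ∏ k, (lam i - minorEig lam U k) =
      roww (Fin.last m) U i * ∏ k, (lam i - lam (i.succAbove k)) := by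
  set W : Matrix (Fin (m+1)) (Fin (m+1)) ℂ := (U : Matrix (Fin (m+1)) (Fin (m+1)) ℂ) with hW
  have h := Matrix.mem_unitaryGroup_iff.1 U.2
  rw [Matrix.star_eq_conjTranspose, ← hW] at h
  have h' : Wᴴ * W = 1 := mul_eq_one_comm.1 h
  set x : ℂ := (lam i : ℂ)
  have e : Matrix.scalar (Fin (m+1)) x - W * Matrix.diagonal (fun j => (lam j : ℂ)) * Wᴴ =
      W * Matrix.diagonal (fun j => x - (lam j : ℂ)) * Wᴴ := by
    rw [← Matrix.diagonal_sub, mul_sub, sub_mul, ← Matrix.scalar_apply,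
      ← (Matrix.scalar_commute x (fun r => mul_comm x r) W).eq,
      mul_assoc (Matrix.scalar (Fin (m+1)) x), h, mul_one]
  have hadj : W.adjugate = W.det • Wᴴ := by
    have : W.adjugate = W.adjugate * (W * Wᴴ) := by rw [h, mul_one]
    rw [this, ← mul_assoc, Matrix.adjugate_mul, Matrix.smul_mul, one_mul]
  have hadj' : (Wᴴ).adjugate = (Wᴴ).det • W := by
    have : (Wᴴ).adjugate = (Wᴴ).adjugate * (Wᴴ * W) := by rw [h', mul_one]
    rw [this, ← mul_assoc, Matrix.adjugate_mul, Matrix.smul_mul, one_mul]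
  have hdet : (Wᴴ).det * W.det = 1 := by rw [← Matrix.det_mul, h', Matrix.det_one]
  have hadj2 : (Matrix.scalar (Fin (m+1)) x - W * Matrix.diagonal (fun j => (lam j : ℂ)) * Wᴴ).adjugate
      = W * Matrix.diagonal (fun a => ∏ j ∈ Finset.univ.erase a, (x - (lam j : ℂ))) * Wᴴ := by
    rw [e, Matrix.adjugate_mul_distrib, Matrix.adjugate_mul_distrib, hadj, hadj',
      Matrix.adjugate_diagonal, Matrix.mul_smul, Matrix.smul_mul, Matrix.mul_smul, smul_smul,
      hdet, one_smul, mul_assoc]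
  have hmin := Matrix.adjugate_fin_succ_eq_det_submatrix (Matrix.scalar (Fin (m+1)) x -
    W * Matrix.diagonal (fun j => (lam j : ℂ)) * Wᴴ) (Fin.last m) (Fin.last m)
  rw [← two_mul, pow_mul, neg_one_sq, one_pow, one_mul, hadj2] at hmin
  have hsub : (Matrix.scalar (Fin (m+1)) x - W * Matrix.diagonal (fun j => (lam j : ℂ)) * Wᴴ).submatrix
      (Fin.last m).succAbove (Fin.last m).succAbove = Matrix.scalar (Fin m) x -
      (W * Matrix.diagonal (fun j => (lam j : ℂ)) * Wᴴ).submatrix (Fin.castLE (Nat.le_succ m))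
        (Fin.castLE (Nat.le_succ m)) := by
    ext a b
    simp only [Matrix.submatrix_apply, Matrix.sub_apply, Fin.succAbove_last, Matrix.scalar_apply,
      Matrix.diagonal_apply, Fin.castSucc_inj]
    rfl
  rw [hsub] at hmin
  have hp := prod_eigsDesc ((conj_diagonal_isHermitian (m+1) lam U).submatrix
    (Fin.castLE (Nat.le_succ m))) (lam i)
  rw [← hmin] at hp
  have : ((∏ k, (lam i - minorEig lam U k) : ℝ) : ℂ) =
      ((roww (Fin.last m) U i * ∏ k, (lam i - lam (i.succAbove k)) : ℝ) : ℂ) := by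
    refine hp.trans ?_
    rw [prod_succAbove_eq i (fun j => lam i - lam j), Matrix.mul_apply,
      Finset.sum_eq_single i]
    · rw [Matrix.mul_diagonal, Matrix.conjTranspose_apply, mul_right_comm, RCLike.star_def,
        Complex.mul_conj, Complex.normSq_eq_norm_sq, roww]
      push_cast; rfl
    · intro b _ hb
      rw [Matrix.mul_diagonal, Finset.prod_eq_zero (i := i) (by simp [hb.symm]) (sub_self _),
        mul_zero, zero_mul]
    · simp
  exact_mod_cast this

lemma Psi_minorEig {m : ℕ} {lam : Fin (m+1) → ℝ} (hlam : StrictAnti lam)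
    (U : Matrix.unitaryGroup (Fin (m+1)) ℂ) :
    Psi lam (Fin.cons 1 (minorEig lam U)) = roww (Fin.last m) U := by
  funext i
  simp only [Psi, Fin.cons_zero, Fin.cons_succ]
  rw [minor_det, one_mul, mul_div_assoc, div_self (d_ne hlam.injective i), mul_one]

lemma minor_law {m : ℕ} {lam : Fin (m+1) → ℝ} (hlam : StrictAnti lam)
    (μH : Measure (Matrix.unitaryGroup (Fin (m+1)) ℂ)) [IsProbabilityMeasure μH]
    (hinv : ∀ g : Matrix.unitaryGroup (Fin (m+1)) ℂ, Measure.map (fun U => g * U) μH = μH) :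
    (volume.restrict (inter lam)).withDensity (fun mu => ENNReal.ofReal (vd mu)) =
      ((K1 (m+1) / K2 m) * ENNReal.ofReal (vd lam)) • Measure.map (minorEig lam) μH := by
  ext A hA
  have hanti : MeasurableSet {mu : Fin m → ℝ | Antitone mu} := by
    have : {mu : Fin m → ℝ | Antitone mu} = ⋂ i, ⋂ j, ⋂ (_ : i ≤ j), {mu | mu j ≤ mu i} := by
      ext mu; simp [Antitone]
    rw [this]
    exact (isClosed_iInter fun i => isClosed_iInter fun j => isClosed_iInter fun _ =>
      isClosed_le (continuous_apply j) (continuous_apply i)).measurableSet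
  set Φ : (Fin m → ℝ) → (Fin (m+1) → ℝ) := fun mu => Psi lam (Fin.cons 1 mu) with hΦ
  have hinj : InjOn Φ {mu : Fin m → ℝ | Antitone mu} := fun mu hmu nu hnu h =>
    (Psi_cons_inj hlam hmu hnu one_ne_zero h).2
  have hB : MeasurableSet (Φ '' (A ∩ {mu : Fin m → ℝ | Antitone mu})) :=
    (hA.inter hanti).image_of_continuousOn_injOn (Psi_cons_continuous lam).continuousOn
      (hinj.mono inter_subset_right)
  have hmem : ∀ mu : Fin m → ℝ, Antitone mu →
      (Φ mu ∈ Φ '' (A ∩ {mu : Fin m → ℝ | Antitone mu}) ↔ mu ∈ A) := by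
    intro mu hmu
    constructor
    · rintro ⟨nu, ⟨h1, h2⟩, h3⟩
      rwa [← hinj h2 hmu h3]
    · intro h
      exact ⟨mu, ⟨h, hmu⟩, rfl⟩
  set B := Φ '' (A ∩ {mu : Fin m → ℝ | Antitone mu}) with hBdef
  have hlaw := row_law_inter hlam (Fin.last m) μH hinv (g := B.indicator 1)
    (measurable_one.indicator hB)
  have e1 : ∫⁻ U, B.indicator 1 (roww (Fin.last m) U) ∂μH = μH (minorEig lam ⁻¹' A) := by
    rw [← lintegral_indicator_one (minorEig_measurable lam hA)]
    refine lintegral_congr fun U => ?_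
    rw [← Psi_minorEig hlam]
    change B.indicator 1 (Φ (minorEig lam U)) = _
    by_cases h : minorEig lam U ∈ A
    · rw [indicator_of_mem ((hmem (minorEig lam U) (eigsDesc_antitone _)).2 h), indicator_of_mem (by exact h)]; rfl
    · rw [indicator_of_notMem (mt (hmem (minorEig lam U) (eigsDesc_antitone _)).1 h), indicator_of_notMem (by exact h)]
  have e2 : ∫⁻ mu in inter lam, ENNReal.ofReal (vd mu) * B.indicator 1 (Psi lam (Fin.cons 1 mu)) =
      (volume.restrict (inter lam)).withDensity (fun mu => ENNReal.ofReal (vd mu)) A := by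
    rw [withDensity_apply _ hA, ← lintegral_indicator hA]
    refine setLIntegral_congr_fun (inter_measurable lam) fun mu hmu => ?_
    have han := (inter_strictAnti hlam hmu).antitone
    by_cases h : mu ∈ A
    · change _ * B.indicator 1 (Φ mu) = _
      rw [indicator_of_mem ((hmem _ han).2 h), indicator_of_mem h]; simp
    · change _ * B.indicator 1 (Φ mu) = _
      rw [indicator_of_notMem (mt (hmem _ han).1 h), indicator_of_notMem h]; simp
  rw [e1, e2] at hlaw
  rw [Measure.smul_apply, Measure.map_apply (minorEig_measurable lam) hA, smul_eq_mul]
  have hv : ENNReal.ofReal (vd lam) ≠ 0 := by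
    simpa using vd_pos hlam.injective
  have hk0 := K2_ne_zero m
  have hkt := K2_ne_top m
  rw [div_eq_mul_inv, mul_right_comm (K1 (m+1)), mul_right_comm, mul_right_comm (K1 (m+1)), hlaw]
  set X := (volume.restrict (inter lam)).withDensity (fun mu => ENNReal.ofReal (vd mu)) A
  calc X = (K2 m * (K2 m)⁻¹) * ((ENNReal.ofReal (vd lam)) * (ENNReal.ofReal (vd lam))⁻¹) * X := by
        rw [ENNReal.mul_inv_cancel hk0 hkt, ENNReal.mul_inv_cancel hv ENNReal.ofReal_ne_top]
        simp
    _ = _ := by ring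

end GZ

namespace GZ
open MeasureTheory Set
open scoped ENNReal Matrix

lemma measurable_inv' (n : ℕ) :
    Measurable (fun U : Matrix.unitaryGroup (Fin n) ℂ => U⁻¹) := by
  refine Measurable.subtype_mk (measurable_of_entries fun i j => ?_)
  exact Complex.continuous_conj.measurable.comp (measurable_coe j i)

lemma right_inv_of_left_inv {n : ℕ} (μ : Measure (Matrix.unitaryGroup (Fin n) ℂ))
    [IsProbabilityMeasure μ]
    (hinv : ∀ g : Matrix.unitaryGroup (Fin n) ℂ, Measure.map (fun U => g * U) μ = μ)
    (g : Matrix.unitaryGroup (Fin n) ℂ) : Measure.map (fun U => U * g) μ = μ := by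
  have hi := measurable_inv' n
  set ρ := Measure.map (fun U => U⁻¹) μ with hρ
  have hρp : IsProbabilityMeasure ρ := Measure.isProbabilityMeasure_map hi.aemeasurable
  have hρi : ∀ g : Matrix.unitaryGroup (Fin n) ℂ, Measure.map (fun U => U * g) ρ = ρ := by
    intro g
    rw [hρ, Measure.map_map (measurable_mul_right g) hi]
    conv_rhs => rw [← hinv g⁻¹, Measure.map_map hi (measurable_mul_left _)]
    congr 1
    funext U
    simp
  have key : μ = ρ := by
    ext A hA
    have hm : MeasurableSet ((fun p : Matrix.unitaryGroup (Fin n) ℂ × Matrix.unitaryGroup (Fin n) ℂ =>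
      p.1 * p.2) ⁻¹' A) := measurable_mul hA
    have h1 : (ρ.prod μ) ((fun p : Matrix.unitaryGroup (Fin n) ℂ × Matrix.unitaryGroup (Fin n) ℂ =>
      p.1 * p.2) ⁻¹' A) = μ A := by
      rw [Measure.prod_apply hm]
      have : ∀ V, μ (Prod.mk V ⁻¹' ((fun p : Matrix.unitaryGroup (Fin n) ℂ ×
          Matrix.unitaryGroup (Fin n) ℂ => p.1 * p.2) ⁻¹' A)) = μ A := by
        intro V
        conv_rhs => rw [← hinv V, Measure.map_apply (measurable_mul_left V) hA]
        rfl
      simp [this]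
    have h2 : (ρ.prod μ) ((fun p : Matrix.unitaryGroup (Fin n) ℂ × Matrix.unitaryGroup (Fin n) ℂ =>
      p.1 * p.2) ⁻¹' A) = ρ A := by
      rw [Measure.prod_apply_symm hm]
      have : ∀ V, ρ ((fun x => (x, V)) ⁻¹' ((fun p : Matrix.unitaryGroup (Fin n) ℂ ×
          Matrix.unitaryGroup (Fin n) ℂ => p.1 * p.2) ⁻¹' A)) = ρ A := by
        intro V
        conv_rhs => rw [← hρi V, Measure.map_apply (measurable_mul_right V) hA]
        rfl
      simp [this]
    rw [← h1, h2]
  rw [key]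
  exact hρi g

lemma unitary_compact (n : ℕ) : CompactSpace (Matrix.unitaryGroup (Fin n) ℂ) := by
  refine isCompact_iff_compactSpace (s := (Matrix.unitaryGroup (Fin n) ℂ : Set (Matrix (Fin n) (Fin n) ℂ))).1 ?_
  have hK : IsCompact (Set.pi univ fun _ : Fin n => Set.pi univ fun _ : Fin n =>
      Metric.closedBall (0 : ℂ) 1) :=
    isCompact_univ_pi fun _ => isCompact_univ_pi fun _ => isCompact_closedBall _ _
  refine hK.of_isClosed_subset ?_ ?_
  · have : (Matrix.unitaryGroup (Fin n) ℂ : Set (Matrix (Fin n) (Fin n) ℂ)) =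
        {A | A * star A = 1} := by
      ext A
      exact Matrix.mem_unitaryGroup_iff
    rw [this]
    exact isClosed_eq (by fun_prop) continuous_const
  · intro U hU i _ j _
    simpa using entry_norm_bound_of_unitary hU i j

lemma unitary_borel (n : ℕ) : BorelSpace (Matrix.unitaryGroup (Fin n) ℂ) := by
  have : BorelSpace (Matrix (Fin n) (Fin n) ℂ) :=
    inferInstanceAs (BorelSpace (Fin n → Fin n → ℂ))
  exact Subtype.borelSpace _

lemma exists_haar (n : ℕ) : ∃ ν : Measure (Matrix.unitaryGroup (Fin n) ℂ),
    IsProbabilityMeasure ν ∧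
    ∀ g : Matrix.unitaryGroup (Fin n) ℂ, Measure.map (fun U => g * U) ν = ν := by
  have := unitary_compact n
  have := unitary_borel n
  have : IsTopologicalGroup (Matrix.unitaryGroup (Fin n) ℂ) :=
    inferInstanceAs (IsTopologicalGroup (unitary (Matrix (Fin n) (Fin n) ℂ)))
  refine ⟨Measure.haarMeasure ⊤, ⟨?_⟩, fun g => ?_⟩
  · exact Measure.haarMeasure_self (K₀ := (⊤ : TopologicalSpace.PositiveCompacts
      (Matrix.unitaryGroup (Fin n) ℂ)))
  · exact map_mul_left_eq_self _ g
end GZ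

namespace GZ
open MeasureTheory Set
open scoped ENNReal Matrix

/-- block embedding of `U(m)` into `U(m+1)` -/
noncomputable def embM {m : ℕ} (V : Matrix (Fin m) (Fin m) ℂ) : Matrix (Fin (m+1)) (Fin (m+1)) ℂ :=
  Matrix.of fun i j => Fin.lastCases (motive := fun _ => ℂ)
    (Fin.lastCases (motive := fun _ => ℂ) 1 (fun _ => 0) j)
    (fun i' => Fin.lastCases (motive := fun _ => ℂ) 0 (fun j' => V i' j') j) i

@[simp] lemma embM_cc {m : ℕ} (V : Matrix (Fin m) (Fin m) ℂ) (i j : Fin m) :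
    embM V i.castSucc j.castSucc = V i j := by simp [embM]
@[simp] lemma embM_cl {m : ℕ} (V : Matrix (Fin m) (Fin m) ℂ) (i : Fin m) :
    embM V i.castSucc (Fin.last m) = 0 := by simp [embM]
@[simp] lemma embM_lc {m : ℕ} (V : Matrix (Fin m) (Fin m) ℂ) (i : Fin m) :
    embM V (Fin.last m) i.castSucc = 0 := by simp [embM]
@[simp] lemma embM_ll {m : ℕ} (V : Matrix (Fin m) (Fin m) ℂ) :
    embM V (Fin.last m) (Fin.last m) = 1 := by simp [embM]

lemma embM_mem {m : ℕ} (V : Matrix.unitaryGroup (Fin m) ℂ) :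
    embM (V : Matrix (Fin m) (Fin m) ℂ) ∈ Matrix.unitaryGroup (Fin (m+1)) ℂ := by
  have h := Matrix.mem_unitaryGroup_iff.1 V.2
  rw [Matrix.mem_unitaryGroup_iff]
  ext i j
  have h' := fun i j => congrFun (congrFun h i) j
  simp only [Matrix.mul_apply, Matrix.star_apply] at h'
  rw [Matrix.mul_apply, Fin.sum_univ_castSucc]
  simp only [Matrix.star_apply]
  refine Fin.lastCases ?_ (fun i => ?_) i <;> refine Fin.lastCases ?_ (fun j => ?_) j
  · simp
  · simp [(Fin.castSucc_lt_last j).ne']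
  · simp [(Fin.castSucc_lt_last i).ne]
  · have := h' i j
    simpa [Matrix.one_apply] using this

lemma embM_conj {m : ℕ} (V : Matrix (Fin m) (Fin m) ℂ) (A : Matrix (Fin (m+1)) (Fin (m+1)) ℂ) :
    (embM V * A * (embM V)ᴴ).submatrix (Fin.castLE (Nat.le_succ m)) (Fin.castLE (Nat.le_succ m)) =
      V * A.submatrix (Fin.castLE (Nat.le_succ m)) (Fin.castLE (Nat.le_succ m)) * Vᴴ := by
  ext i j
  change (embM V * A * (embM V)ᴴ) i.castSucc j.castSucc = _
  simp only [Matrix.mul_apply, Matrix.conjTranspose_apply, Fin.sum_univ_castSucc, embM_cc, embM_cl,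
    zero_mul, add_zero, star_zero, mul_zero]
  rfl

/-- the codimension one minor -/
noncomputable def minorMat {m : ℕ} (lam : Fin (m+1) → ℝ) (U : Matrix.unitaryGroup (Fin (m+1)) ℂ) :
    Matrix (Fin m) (Fin m) ℂ :=
  ((U : Matrix (Fin (m+1)) (Fin (m+1)) ℂ) * Matrix.diagonal (fun i => (lam i : ℂ)) *
      (U : Matrix (Fin (m+1)) (Fin (m+1)) ℂ)ᴴ).submatrix (Fin.castLE (Nat.le_succ m))
      (Fin.castLE (Nat.le_succ m))

lemma minorMat_measurable {m : ℕ} (lam : Fin (m+1) → ℝ) : Measurable (minorMat lam) :=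
  (measurable_submatrix _).comp (measurable_conj measurable_id measurable_const)

lemma minorMat_emb {m : ℕ} (lam : Fin (m+1) → ℝ) (U : Matrix.unitaryGroup (Fin (m+1)) ℂ)
    (V : Matrix.unitaryGroup (Fin m) ℂ) :
    minorMat lam (⟨embM V, embM_mem V⟩ * U) =
      (V : Matrix (Fin m) (Fin m) ℂ) * minorMat lam U * (V : Matrix (Fin m) (Fin m) ℂ)ᴴ := by
  rw [minorMat, minorMat, ← embM_conj]
  congr 1
  simp only [Matrix.UnitaryGroup.mul_val, Matrix.conjTranspose_mul, mul_assoc]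

lemma spectral_desc {n : ℕ} {A : Matrix (Fin n) (Fin n) ℂ} (hA : A.IsHermitian) :
    ∃ W : Matrix.unitaryGroup (Fin n) ℂ, A = (W : Matrix (Fin n) (Fin n) ℂ) *
      Matrix.diagonal (fun i => (eigsDesc hA i : ℂ)) * (W : Matrix (Fin n) (Fin n) ℂ)ᴴ := by
  set Q : Matrix (Fin n) (Fin n) ℂ := (hA.eigenvectorUnitary : Matrix (Fin n) (Fin n) ℂ) with hQ
  have hQu := Matrix.mem_unitaryGroup_iff.1 hA.eigenvectorUnitary.2
  rw [← hQ, Matrix.star_eq_conjTranspose] at hQu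
  set σ : Equiv.Perm (Fin n) := Fin.revPerm.trans (Tuple.sort hA.eigenvalues)
  have hs : A = Q * Matrix.diagonal (fun i => (hA.eigenvalues i : ℂ)) * Qᴴ := hA.spectral_theorem
  refine ⟨⟨Q.submatrix id σ, ?_⟩, ?_⟩
  · rw [Matrix.mem_unitaryGroup_iff, Matrix.star_eq_conjTranspose, Matrix.conjTranspose_submatrix,
      Matrix.submatrix_mul_equiv, hQu, Matrix.submatrix_id_id]
  · have hd : Matrix.diagonal (fun i => (eigsDesc hA i : ℂ)) =
        (Matrix.diagonal (fun i => (hA.eigenvalues i : ℂ))).submatrix σ σ := by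
      rw [Matrix.submatrix_diagonal_equiv]
      rfl
    change A = Q.submatrix id σ * _ * (Q.submatrix id σ)ᴴ
    rw [hd, Matrix.conjTranspose_submatrix, Matrix.submatrix_mul_equiv, Matrix.submatrix_mul_equiv,
      Matrix.submatrix_id_id]
    exact hs

lemma minor_conj {m : ℕ} (lam : Fin (m+1) → ℝ)
    (μH : Measure (Matrix.unitaryGroup (Fin (m+1)) ℂ)) [IsProbabilityMeasure μH]
    (hinv : ∀ g : Matrix.unitaryGroup (Fin (m+1)) ℂ, Measure.map (fun U => g * U) μH = μH)
    (ν : Measure (Matrix.unitaryGroup (Fin m) ℂ)) [IsProbabilityMeasure ν]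
    (hν : ∀ g : Matrix.unitaryGroup (Fin m) ℂ, Measure.map (fun U => g * U) ν = ν)
    {G : Matrix (Fin m) (Fin m) ℂ → ℝ≥0∞} (hG : Measurable G) :
    ∫⁻ U, G (minorMat lam U) ∂μH = ∫⁻ U, ∫⁻ V, G ((V : Matrix (Fin m) (Fin m) ℂ) *
      Matrix.diagonal (fun i => (minorEig lam U i : ℂ)) * (V : Matrix (Fin m) (Fin m) ℂ)ᴴ) ∂ν ∂μH := by
  have h1 : ∀ V : Matrix.unitaryGroup (Fin m) ℂ, ∫⁻ U, G (minorMat lam U) ∂μH =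
      ∫⁻ U, G ((V : Matrix (Fin m) (Fin m) ℂ) * minorMat lam U *
        (V : Matrix (Fin m) (Fin m) ℂ)ᴴ) ∂μH := by
    intro V
    conv_lhs => rw [← hinv ⟨embM V, embM_mem V⟩]
    rw [lintegral_map (f := fun U => G (minorMat lam U)) (hG.comp (minorMat_measurable lam)) (measurable_mul_left _)]
    simp only [minorMat_emb]
  have h2 : ∫⁻ U, G (minorMat lam U) ∂μH = ∫⁻ V : Matrix.unitaryGroup (Fin m) ℂ,
      ∫⁻ U, G ((V : Matrix (Fin m) (Fin m) ℂ) * minorMat lam U *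
        (V : Matrix (Fin m) (Fin m) ℂ)ᴴ) ∂μH ∂ν := by
    simp only [← h1, lintegral_const, measure_univ, mul_one]
  rw [h2, lintegral_lintegral_swap]
  · refine lintegral_congr fun U => ?_
    obtain ⟨W, hW⟩ := spectral_desc ((conj_diagonal_isHermitian (m+1) lam U).submatrix
      (Fin.castLE (Nat.le_succ m)))
    change minorMat lam U = _ at hW
    change _ = _ * Matrix.diagonal (fun i => (minorEig lam U i : ℂ)) * _ at hW
    rw [hW]
    have hm : Measurable fun V : Matrix.unitaryGroup (Fin m) ℂ => G ((V : Matrix (Fin m) (Fin m) ℂ) *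
      Matrix.diagonal (fun i => (minorEig lam U i : ℂ)) * (V : Matrix (Fin m) (Fin m) ℂ)ᴴ) :=
      hG.comp (measurable_conj measurable_id measurable_const)
    conv_rhs => rw [← right_inv_of_left_inv ν hν W]
    rw [lintegral_map hm (measurable_mul_right W)]
    refine lintegral_congr fun V => ?_
    simp only [Matrix.UnitaryGroup.mul_val, Matrix.conjTranspose_mul, mul_assoc]
  · exact (hG.comp (measurable_conj measurable_fst
      ((minorMat_measurable lam).comp measurable_snd))).aemeasurable
end GZ

namespace GZ
open MeasureTheory Set
open scoped ENNReal Matrix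

/-- index type -/
abbrev II (m : ℕ) := Σ k : Fin m, Fin ((k : ℕ) + 1)

/-- splitting off the top row -/
noncomputable def eII (m : ℕ) : II m ⊕ Fin (m+1) ≃ II (m+1) :=
  Equiv.ofBijective (fun p => Sum.elim (fun q : II m => (⟨q.1.castSucc, q.2⟩ : II (m+1)))
    (fun i => (⟨Fin.last m, i⟩ : II (m+1))) p) (by
    constructor
    · rintro (⟨k, i⟩ | i) (⟨l, j⟩ | j) h
      · simp only [Sum.elim_inl, Sigma.mk.injEq, Fin.castSucc_inj] at h
        obtain ⟨rfl, h⟩ := h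
        simp only [heq_eq_eq] at h
        subst h; rfl
      · simp only [Sum.elim_inl, Sum.elim_inr, Sigma.mk.injEq] at h
        exact absurd h.1 (Fin.castSucc_lt_last k).ne
      · simp only [Sum.elim_inl, Sum.elim_inr, Sigma.mk.injEq] at h
        exact absurd h.1 (Fin.castSucc_lt_last l).ne'
      · simp only [Sum.elim_inr, Sigma.mk.injEq, heq_eq_eq, true_and] at h
        subst h; rfl
    · rintro ⟨k, i⟩
      induction k using Fin.lastCases with
      | last => exact ⟨Sum.inr i, rfl⟩
      | cast k => exact ⟨Sum.inl ⟨k, i⟩, rfl⟩)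

/-- gluing of a tableau and a top row -/
noncomputable def glue (m : ℕ) : (II m → ℝ) × (Fin (m+1) → ℝ) ≃ᵐ (II (m+1) → ℝ) :=
  (MeasurableEquiv.sumPiEquivProdPi (fun _ : II m ⊕ Fin (m+1) => ℝ)).symm.trans
    (MeasurableEquiv.piCongrLeft (fun _ => ℝ) (eII m))

lemma glue_preserving (m : ℕ) : MeasurePreserving (glue m) :=
  (volume_measurePreserving_piCongrLeft (fun _ => ℝ) (eII m)).comp
    (volume_measurePreserving_sumPiEquivProdPi_symm (fun _ : II m ⊕ Fin (m+1) => ℝ))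

lemma glue_inl (m : ℕ) (x : II m → ℝ) (y : Fin (m+1) → ℝ) (k : Fin m) (i : Fin ((k : ℕ)+1)) :
    glue m (x, y) ⟨k.castSucc, i⟩ = x ⟨k, i⟩ := by
  change Equiv.piCongrLeft (fun _ => ℝ) (eII m) _ (eII m (Sum.inl ⟨k, i⟩)) = _
  rw [Equiv.piCongrLeft_apply_apply]
  rfl

lemma glue_inr (m : ℕ) (x : II m → ℝ) (y : Fin (m+1) → ℝ) (i : Fin (m+1)) :
    glue m (x, y) ⟨Fin.last m, i⟩ = y i := by
  change Equiv.piCongrLeft (fun _ => ℝ) (eII m) _ (eII m (Sum.inr i)) = _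
  rw [Equiv.piCongrLeft_apply_apply]
  rfl

/-- partial sums -/
noncomputable def psum {m : ℕ} (mu : Fin m → ℝ) : Fin m → ℝ := fun i => ∑ j ∈ Finset.Iic i, mu j

lemma psum_preserving (m : ℕ) : MeasurePreserving (psum (m := m)) := by
  set M : Matrix (Fin m) (Fin m) ℝ := Matrix.of fun i j => if j ≤ i then 1 else 0 with hM
  have hdet : M.det = 1 := by
    rw [Matrix.det_of_isLowerTriangular]
    · simp [hM]
    · intro i j hij
      have : i < j := hij
      simp [hM, this]
  have h := Real.map_matrix_volume_pi_eq_smul_volume_pi (M := M) (by rw [hdet]; exact one_ne_zero)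
  have e : ⇑(Matrix.toLin' M) = psum (m := m) := by
    funext mu i
    simp [Matrix.toLin'_apply, Matrix.mulVec, dotProduct, hM, psum, Finset.sum_ite,
      ← Finset.filter_ge_eq_Iic]
  rw [e, hdet] at h
  refine ⟨?_, by simpa using h⟩
  rw [← e]
  exact (LinearMap.continuous_of_finiteDimensional _).measurable

lemma gzFull_measurable (n : ℕ) (lam : Fin n → ℝ) (k i : ℕ) :
    Measurable fun x => gzFull n lam x k i := by
  unfold gzFull
  split_ifs
  · exact measurable_const
  · exact measurable_pi_apply _
  · exact measurable_const
  · exact measurable_const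

lemma gzPolytope_measurable (n : ℕ) (lam : Fin n → ℝ) : MeasurableSet (gzPolytope n lam) := by
  have : gzPolytope n lam = ⋂ k : ℕ, ⋂ i : ℕ, ⋂ (_ : 1 ≤ i), ⋂ (_ : i ≤ k), ⋂ (_ : k < n),
      ({x | gzFull n lam x (k + 1) (i - 1) + gzFull n lam x k i ≤
        gzFull n lam x (k + 1) i + gzFull n lam x k (i - 1)} ∩
      {x | gzFull n lam x (k + 1) (i + 1) + gzFull n lam x k (i - 1) ≤
        gzFull n lam x (k + 1) i + gzFull n lam x k i}) := by
    ext x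
    simp only [gzPolytope, mem_iInter, mem_inter_iff, mem_ofPred_eq, ge_iff_le]
  rw [this]
  have hm := gzFull_measurable n lam
  exact MeasurableSet.iInter fun k => MeasurableSet.iInter fun i => MeasurableSet.iInter fun _ =>
    MeasurableSet.iInter fun _ => MeasurableSet.iInter fun _ =>
    (measurableSet_le ((hm _ _).add (hm _ _)) ((hm _ _).add (hm _ _))).inter
      (measurableSet_le ((hm _ _).add (hm _ _)) ((hm _ _).add (hm _ _)))

/-- polytope with simplified index type -/
def gzP (m : ℕ) (lam : Fin (m+1) → ℝ) : Set (II m → ℝ) := gzPolytope (m+1) lam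

lemma gzP_measurable (m : ℕ) (lam : Fin (m+1) → ℝ) : MeasurableSet (gzP m lam) :=
  gzPolytope_measurable (m+1) lam

lemma gzFull_glue (m : ℕ) (lam : Fin (m+2) → ℝ) (mu : Fin (m+1) → ℝ) (x : II m → ℝ) (k i : ℕ)
    (hk : k ≤ m+1) :
    gzFull (m+2) lam (glue m (x, psum mu)) k i = gzFull (m+1) mu x k i := by
  unfold gzFull
  by_cases hi : i = 0
  · simp [hi]
  rw [if_neg hi, if_neg hi]
  by_cases hik : 1 ≤ i ∧ i ≤ k
  · rw [dif_pos (by omega)]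
    rcases Nat.lt_or_ge k (m+1) with h | h
    · rw [dif_pos (by omega)]
      exact glue_inl m x (psum mu) ⟨k-1, by omega⟩ ⟨i-1, by simp; omega⟩
    · obtain rfl : k = m+1 := by omega
      rw [dif_neg (by omega), dif_pos (by omega)]
      refine (glue_inr m x (psum mu) ⟨i-1, by omega⟩).trans ?_
      rw [psum]
      congr 1
      ext j
      simp only [Finset.mem_Iic, Finset.mem_filter, Finset.mem_univ, true_and, Fin.le_def]
      omega
  · rw [dif_neg (by omega), dif_neg (by omega), dif_neg (by omega), dif_neg (by omega)]

lemma gzFull_top (n : ℕ) (lam : Fin (n+1) → ℝ) (x : II n → ℝ) (i : ℕ) (hi : i ≤ n+1) :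
    gzFull (n+1) lam x (n+1) i =
      ∑ j ∈ Finset.univ.filter (fun j : Fin (n+1) => (j : ℕ) < i), lam j := by
  unfold gzFull
  by_cases h : i = 0
  · simp [h]
  rw [if_neg h, dif_neg (by omega), dif_pos (by omega)]

lemma sum_filter_succ {n : ℕ} (lam : Fin n → ℝ) (i : ℕ) (hi : i < n) :
    ∑ j ∈ Finset.univ.filter (fun j : Fin n => (j : ℕ) < i + 1), lam j =
      ∑ j ∈ Finset.univ.filter (fun j : Fin n => (j : ℕ) < i), lam j + lam ⟨i, hi⟩ := by
  have : Finset.univ.filter (fun j : Fin n => (j : ℕ) < i + 1) =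
      insert ⟨i, hi⟩ (Finset.univ.filter (fun j : Fin n => (j : ℕ) < i)) := by
    ext j
    simp only [Finset.mem_filter, Finset.mem_univ, true_and, Finset.mem_insert, Fin.ext_iff]
    omega
  rw [this, Finset.sum_insert (by simp), add_comm]

lemma glue_mem_iff (m : ℕ) (lam : Fin (m+2) → ℝ) (mu : Fin (m+1) → ℝ) (x : II m → ℝ) :
    glue m (x, psum mu) ∈ gzP (m+1) lam ↔
      mu ∈ Set.pi univ (fun k : Fin (m+1) => Icc (lam k.succ) (lam k.castSucc)) ∧ x ∈ gzP m mu := by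
  have top : ∀ i : ℕ, (hi : i < m+1) →
      ((gzFull (m+2) lam (glue m (x, psum mu)) (m + 1 + 1) (i+1) +
          gzFull (m+2) lam (glue m (x, psum mu)) (m+1) i ≥
        gzFull (m+2) lam (glue m (x, psum mu)) (m + 1 + 1) i +
          gzFull (m+2) lam (glue m (x, psum mu)) (m+1) (i+1) ∧
       gzFull (m+2) lam (glue m (x, psum mu)) (m + 1 + 1) (i+1) +
          gzFull (m+2) lam (glue m (x, psum mu)) (m+1) (i+1) ≥
        gzFull (m+2) lam (glue m (x, psum mu)) (m + 1 + 1) (i + 1 + 1) +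
          gzFull (m+2) lam (glue m (x, psum mu)) (m+1) i) ↔
      mu ⟨i, hi⟩ ∈ Icc (lam (⟨i, hi⟩ : Fin (m+1)).succ) (lam (⟨i, hi⟩ : Fin (m+1)).castSucc)) := by
    intro i hi
    rw [gzFull_glue m lam mu x (m+1) i le_rfl, gzFull_glue m lam mu x (m+1) (i+1) le_rfl,
      gzFull_top (m+1) lam _ i (by omega), gzFull_top (m+1) lam _ (i+1) (by omega),
      gzFull_top (m+1) lam _ (i+1+1) (by omega), gzFull_top m mu _ i (by omega),
      gzFull_top m mu _ (i+1) (by omega), sum_filter_succ lam (i+1) (by omega),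
      sum_filter_succ lam i (by omega), sum_filter_succ mu i (by omega), mem_Icc]
    change _ ↔ lam ⟨i+1, by omega⟩ ≤ _ ∧ _ ≤ lam ⟨i, by omega⟩
    constructor
    · rintro ⟨h1, h2⟩; constructor <;> linarith
    · rintro ⟨h1, h2⟩; constructor <;> linarith
  constructor
  · intro h
    refine ⟨fun k _ => ?_, ?_⟩
    · exact (top k k.2).1 (h (m+1) (k+1) (by omega) (by omega) (by omega))
    · intro k i h1 h2 h3
      have := h k i h1 h2 (by omega)
      simp only [gzFull_glue m lam mu x k _ h3.le, gzFull_glue m lam mu x (k+1) _ h3] at this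
      exact this
  · rintro ⟨hI, hx⟩ k i h1 h2 h3
    rcases Nat.lt_or_ge k (m+1) with h | h
    · have := hx k i h1 h2 h
      simp only [gzFull_glue m lam mu x k _ h.le, gzFull_glue m lam mu x (k+1) _ h]
      exact this
    · obtain rfl : k = m+1 := by omega
      obtain ⟨i, rfl⟩ : ∃ i', i = i' + 1 := ⟨i-1, by omega⟩
      exact (top i (by omega)).2 (hI ⟨i, by omega⟩ (mem_univ _))
end GZ

namespace GZ
open MeasureTheory Set
open scoped ENNReal Matrix

/-- tableau of a Hermitian matrix below the top row -/
noncomputable def gzH {m : ℕ} {A : Matrix (Fin (m+1)) (Fin (m+1)) ℂ} (hA : A.IsHermitian) :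
    II m → ℝ := fun p => LH hA ((p.1 : ℕ) + 1) ((p.2 : ℕ) + 1)

/-- the Gelfand-Zeitlin map with simplified index type -/
noncomputable def gzp (m : ℕ) (lam : Fin (m+1) → ℝ) (U : Matrix.unitaryGroup (Fin (m+1)) ℂ) :
    II m → ℝ := gzPoint (m+1) lam U

lemma gzH_congr {m : ℕ} {A B : Matrix (Fin (m+1)) (Fin (m+1)) ℂ} (h : A = B) (hA : A.IsHermitian)
    (hB : B.IsHermitian) : gzH hA = gzH hB := by
  subst h; rfl

lemma gzH_measurable {Ω : Type*} [MeasurableSpace Ω] {m : ℕ}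
    {M : Ω → Matrix (Fin (m+1)) (Fin (m+1)) ℂ} (hM : Measurable M) (hH : ∀ ω, (M ω).IsHermitian) :
    Measurable (fun ω => gzH (hH ω)) := by
  refine measurable_pi_lambda _ fun p => ?_
  obtain ⟨k, i⟩ := p
  have h : 1 ≤ (i : ℕ) + 1 ∧ (i : ℕ) + 1 ≤ (k : ℕ) + 1 ∧ (k : ℕ) + 1 ≤ m + 1 := by omega
  simp only [gzH, LH, dif_pos h, lMap]
  refine Finset.measurable_sum _ fun j _ => ?_
  exact measurable_pi_iff.1 (eigsDesc_measurable ((measurable_submatrix h.2.2).comp hM)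
    (fun ω => (hH ω).submatrix (Fin.castLE h.2.2))) j

lemma psum_measurable (m : ℕ) : Measurable (psum (m := m)) := (psum_preserving m).measurable

lemma gz_decomp (m : ℕ) (lam : Fin (m+2) → ℝ) (U : Matrix.unitaryGroup (Fin (m+2)) ℂ)
    (h : (minorMat lam U).IsHermitian) :
    gzp (m+1) lam U = glue m (gzH h, psum (eigsDesc h)) := by
  funext p
  obtain ⟨k, i⟩ := p
  induction k using Fin.lastCases with
  | last =>
    refine Eq.trans ?_ (glue_inr m _ _ i).symm
    have hh : 1 ≤ (i : ℕ) + 1 ∧ (i : ℕ) + 1 ≤ m + 1 ∧ m + 1 ≤ m + 2 := by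
      have : (i : ℕ) < m + 1 := i.2
      omega
    change LH (conj_diagonal_isHermitian (m+2) lam U) (m+1) ((i : ℕ) + 1) = _
    rw [LH, dif_pos hh]
    rfl
  | cast k =>
    refine Eq.trans ?_ (glue_inl m _ _ k i).symm
    have hh : 1 ≤ (i : ℕ) + 1 ∧ (i : ℕ) + 1 ≤ (k : ℕ) + 1 ∧ (k : ℕ) + 1 ≤ m + 2 := by
      have : (i : ℕ) < (k : ℕ) + 1 := i.2
      omega
    have hh' : 1 ≤ (i : ℕ) + 1 ∧ (i : ℕ) + 1 ≤ (k : ℕ) + 1 ∧ (k : ℕ) + 1 ≤ m + 1 := by omega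
    change LH (conj_diagonal_isHermitian (m+2) lam U) ((k : ℕ)+1) ((i : ℕ) + 1) = LH h ((k : ℕ)+1) ((i : ℕ) + 1)
    rw [LH, dif_pos hh, LH, dif_pos hh']
    rfl

/-- Hermitian part -/
noncomputable def hermP {n : ℕ} (A : Matrix (Fin n) (Fin n) ℂ) : Matrix (Fin n) (Fin n) ℂ :=
  Matrix.of fun i j => (A i j + star (A j i)) / 2

lemma hermP_isHermitian {n : ℕ} (A : Matrix (Fin n) (Fin n) ℂ) : (hermP A).IsHermitian := by
  ext i j
  simp [hermP, add_comm]

lemma hermP_eq {n : ℕ} {A : Matrix (Fin n) (Fin n) ℂ} (hA : A.IsHermitian) : hermP A = A := by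
  ext i j
  rw [hermP, Matrix.of_apply, hA.apply]
  ring

lemma hermP_measurable {n : ℕ} : Measurable (hermP (n := n)) := by
  refine measurable_of_entries fun i j => ?_
  have h : ∀ i j : Fin n, Measurable fun A : Matrix (Fin n) (Fin n) ℂ => A i j := fun i j =>
    (measurable_pi_apply j).comp (measurable_pi_apply i)
  exact ((h i j).add (Complex.continuous_conj.measurable.comp (h j i))).div_const 2

lemma gz_measurable_joint (m : ℕ) : Measurable
    (fun p : (Fin (m+1) → ℝ) × Matrix.unitaryGroup (Fin (m+1)) ℂ => gzp m p.1 p.2) :=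
  gzH_measurable (measurable_conj measurable_snd (measurable_diag.comp measurable_fst))
    (fun p => conj_diagonal_isHermitian (m+1) p.1 p.2)

lemma gzp_measurable (m : ℕ) (lam : Fin (m+1) → ℝ) : Measurable (gzp m lam) :=
  gzH_measurable (measurable_conj measurable_id measurable_const)
    (fun U => conj_diagonal_isHermitian (m+1) lam U)

lemma lintegral_gzP (m : ℕ) (lam : Fin (m+2) → ℝ) {F : (II (m+1) → ℝ) → ℝ≥0∞} (hF : Measurable F) :
    ∫⁻ x in gzP (m+1) lam, F x =
      ∫⁻ mu in inter lam, ∫⁻ x in gzP m mu, F (glue m (x, psum mu)) := by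
  have hG : Measurable ((gzP (m+1) lam).indicator F) := hF.indicator (gzP_measurable _ _)
  rw [← lintegral_indicator (gzP_measurable _ _), ← (glue_preserving m).lintegral_comp hG]
  have hG' : Measurable fun p : (II m → ℝ) × (Fin (m+1) → ℝ) =>
      (gzP (m+1) lam).indicator F (glue m p) := hG.comp (glue m).measurable
  rw [Measure.volume_eq_prod, lintegral_prod_symm' _ hG',
    ← (psum_preserving (m+1)).lintegral_comp hG'.lintegral_prod_left']
  set S : Set (Fin (m+1) → ℝ) :=
    Set.pi univ (fun k : Fin (m+1) => Icc (lam k.succ) (lam k.castSucc)) with hS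
  have hSm : MeasurableSet S := MeasurableSet.univ_pi fun _ => measurableSet_Icc
  have h1 : ∀ mu : Fin (m+1) → ℝ, ∫⁻ x : II m → ℝ, (gzP (m+1) lam).indicator F (glue m (x, psum mu)) =
      S.indicator (fun mu => ∫⁻ x in gzP m mu, F (glue m (x, psum mu))) mu := by
    intro mu
    by_cases hmu : mu ∈ S
    · rw [indicator_of_mem hmu, ← lintegral_indicator (gzP_measurable _ _)]
      refine lintegral_congr fun x => ?_
      by_cases hx : x ∈ gzP m mu
      · rw [indicator_of_mem hx, indicator_of_mem ((glue_mem_iff m lam mu x).2 ⟨hmu, hx⟩)]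
      · rw [indicator_of_notMem hx,
          indicator_of_notMem (fun h => hx ((glue_mem_iff m lam mu x).1 h).2)]
    · rw [indicator_of_notMem hmu]
      refine (lintegral_congr fun x => ?_).trans lintegral_zero
      rw [indicator_of_notMem (fun h => hmu ((glue_mem_iff m lam mu x).1 h).1)]
  simp only [h1]
  rw [lintegral_indicator hSm]
  have hae : inter lam =ᵐ[volume] S := by
    rw [hS, inter, volume_pi, Set.pi_univ_Icc]
    exact Measure.univ_pi_Ioo_ae_eq_Icc (μ := fun _ : Fin (m+1) => (volume : Measure ℝ))
  rw [Measure.restrict_congr_set hae]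

lemma lintegral_gz_step (m : ℕ) (lam : Fin (m+2) → ℝ)
    (μH : Measure (Matrix.unitaryGroup (Fin (m+2)) ℂ)) [IsProbabilityMeasure μH]
    (hinv : ∀ g : Matrix.unitaryGroup (Fin (m+2)) ℂ, Measure.map (fun U => g * U) μH = μH)
    (ν : Measure (Matrix.unitaryGroup (Fin (m+1)) ℂ)) [IsProbabilityMeasure ν]
    (hν : ∀ g : Matrix.unitaryGroup (Fin (m+1)) ℂ, Measure.map (fun U => g * U) ν = ν)
    {F : (II (m+1) → ℝ) → ℝ≥0∞} (hF : Measurable F) :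
    ∫⁻ U, F (gzp (m+1) lam U) ∂μH = ∫⁻ U, ∫⁻ V,
      F (glue m (gzp m (minorEig lam U) V, psum (minorEig lam U))) ∂ν ∂μH := by
  set G : Matrix (Fin (m+1)) (Fin (m+1)) ℂ → ℝ≥0∞ := fun A =>
    F (glue m (gzH (hermP_isHermitian A), psum (eigsDesc (hermP_isHermitian A)))) with hG
  have hGm : Measurable G := hF.comp ((glue m).measurable.comp
    ((gzH_measurable hermP_measurable _).prodMk ((psum_measurable _).comp
      (eigsDesc_measurable hermP_measurable _))))
  have h := minor_conj lam μH hinv ν hν hGm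
  have hm : ∀ U, (minorMat lam U).IsHermitian := fun U =>
    (conj_diagonal_isHermitian (m+1+1) lam U).submatrix _
  have e1 : ∀ U, G (minorMat lam U) = F (gzp (m+1) lam U) := by
    intro U
    rw [gz_decomp m lam U (hm U)]
    simp only [hG]
    rw [gzH_congr (hermP_eq (hm U)) _ (hm U), eigsDesc_congr (hermP_eq (hm U)) _ (hm U)]
  have e2 : ∀ (U : Matrix.unitaryGroup (Fin (m+2)) ℂ) (V : Matrix.unitaryGroup (Fin (m+1)) ℂ),
      G ((V : Matrix (Fin (m+1)) (Fin (m+1)) ℂ) *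
      Matrix.diagonal (fun i => (minorEig lam U i : ℂ)) * (V : Matrix (Fin (m+1)) (Fin (m+1)) ℂ)ᴴ) =
      F (glue m (gzp m (minorEig lam U) V, psum (minorEig lam U))) := by
    intro U V
    have hh := conj_diagonal_isHermitian (m+1) (minorEig lam U) V
    simp only [hG]
    rw [gzH_congr (hermP_eq hh) _ hh, eigsDesc_congr (hermP_eq hh) _ hh,
      eigsDesc_conj_diagonal V (mu := minorEig lam U) (eigsDesc_antitone _)]
    rfl
  simp only [e1, e2] at h
  exact h

lemma key (m : ℕ) : ∃ c : ℝ≥0∞, c ≠ 0 ∧ c ≠ ∞ ∧ ∀ lam : Fin (m+1) → ℝ, StrictAnti lam →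
    ∀ μH : Measure (Matrix.unitaryGroup (Fin (m+1)) ℂ), IsProbabilityMeasure μH →
    (∀ g : Matrix.unitaryGroup (Fin (m+1)) ℂ, Measure.map (fun U => g * U) μH = μH) →
    ∀ F : (II m → ℝ) → ℝ≥0∞, Measurable F →
    ∫⁻ x in gzP m lam, F x = (c * ENNReal.ofReal (vd lam)) * ∫⁻ U, F (gzp m lam U) ∂μH := by
  induction m with
  | zero =>
    refine ⟨1, one_ne_zero, ENNReal.one_ne_top, fun lam hlam μH hp hinv F hF => ?_⟩
    have hP : gzP 0 lam = univ := by
      refine eq_univ_of_forall fun x k i h1 h2 h3 => ?_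
      omega
    have hv : vd lam = 1 := by simp [vd]
    have hF' : ∀ x, F x = F default := fun x => congrArg F (Subsingleton.elim _ _)
    rw [hP, Measure.restrict_univ, hv]
    simp only [hF', lintegral_const, measure_univ]
    simp [volume_pi]
  | succ m ih =>
    obtain ⟨c, hc0, hct, hc⟩ := ih
    refine ⟨c * (K1 (m+1+1) / K2 (m+1)), ?_, ?_, fun lam hlam μH hp hinv F hF => ?_⟩
    · exact mul_ne_zero hc0 (ENNReal.div_ne_zero.2 ⟨K1_ne_zero _, K2_ne_top _⟩)
    · exact ENNReal.mul_ne_top hct (ENNReal.div_ne_top (K1_ne_top _) (K2_ne_zero _))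
    obtain ⟨ν, hνp, hν⟩ := exists_haar (m+1)
    set H : (Fin (m+1) → ℝ) → ℝ≥0∞ := fun mu => ∫⁻ V, F (glue m (gzp m mu V, psum mu)) ∂ν with hH
    have hHm : Measurable H := by
      refine Measurable.lintegral_prod_right' (f := fun p : (Fin (m+1) → ℝ) ×
        Matrix.unitaryGroup (Fin (m+1)) ℂ => F (glue m (gzp m p.1 p.2, psum p.1))) ?_
      exact hF.comp ((glue m).measurable.comp ((gz_measurable_joint m).prodMk
        ((psum_measurable _).comp measurable_fst)))
    have h1 : ∫⁻ x in gzP (m+1) lam, F x =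
        ∫⁻ mu in inter lam, c * (ENNReal.ofReal (vd mu) * H mu) := by
      rw [lintegral_gzP m lam hF]
      refine setLIntegral_congr_fun (inter_measurable lam) fun mu hmu => ?_
      have := hc mu (inter_strictAnti hlam hmu) ν hνp hν (fun x => F (glue m (x, psum mu)))
        (hF.comp ((glue m).measurable.comp (measurable_id.prodMk measurable_const)))
      refine this.trans ?_
      rw [mul_assoc]
    have hvm : Measurable fun mu : Fin (m+1) → ℝ => ENNReal.ofReal (vd mu) :=
      vd_measurable.ennreal_ofReal
    rw [h1, lintegral_const_mul (f := fun mu => ENNReal.ofReal (vd mu) * H mu) _ (hvm.mul hHm), lintegral_gz_step m lam μH hinv ν hν hF]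
    have h2 : ∫⁻ mu in inter lam, ENNReal.ofReal (vd mu) * H mu =
        ∫⁻ mu, H mu ∂((volume.restrict (inter lam)).withDensity
          (fun mu => ENNReal.ofReal (vd mu))) := by
      rw [lintegral_withDensity_eq_lintegral_mul _ hvm hHm]
      rfl
    rw [h2, minor_law hlam μH hinv, lintegral_smul_measure,
      lintegral_map hHm (minorEig_measurable lam), smul_eq_mul]
    ring

lemma vd_ofReal_ne {n : ℕ} {lam : Fin n → ℝ} (hlam : StrictAnti lam) :
    ENNReal.ofReal (vd lam) ≠ 0 := by
  simpa using vd_pos hlam.injective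

lemma main_aux (m : ℕ) (lam : Fin (m+1) → ℝ) (hlam : StrictAnti lam)
    (μH : Measure (Matrix.unitaryGroup (Fin (m+1)) ℂ))
    (hprob : IsProbabilityMeasure μH)
    (hinv : ∀ g : Matrix.unitaryGroup (Fin (m+1)) ℂ,
      Measure.map (fun U => g * U) μH = μH) :
    Measure.map (gzp m lam) μH =
      (volume (gzP m lam))⁻¹ • volume.restrict (gzP m lam) := by
  obtain ⟨c, hc0, hct, hc⟩ := key m
  have hk := hc lam hlam μH hprob hinv
  have hvol : volume (gzP m lam) = c * ENNReal.ofReal (vd lam) := by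
    have := hk (fun _ => 1) measurable_const
    simpa using this
  have h0 : c * ENNReal.ofReal (vd lam) ≠ 0 := mul_ne_zero hc0 (vd_ofReal_ne hlam)
  have ht : c * ENNReal.ofReal (vd lam) ≠ ∞ := ENNReal.mul_ne_top hct ENNReal.ofReal_ne_top
  ext A hA
  have h := hk (A.indicator 1) (measurable_one.indicator hA)
  rw [lintegral_indicator_one hA] at h
  have e : ∫⁻ U, A.indicator 1 (gzp m lam U) ∂μH = μH (gzp m lam ⁻¹' A) := by
    rw [← lintegral_indicator_one (gzp_measurable m lam hA)]
    rfl
  rw [Measure.smul_apply, h, e, hvol, Measure.map_apply (gzp_measurable m lam) hA, smul_eq_mul,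
    ← mul_assoc, ENNReal.inv_mul_cancel h0 ht, one_mul]
end GZ

open MeasureTheory in
/-- The pushforward of the Haar probability measure on `U(n)` under the
Gelfand–Zeitlin map `U ↦ (lᵢ((U D U*)^{(k)}))` is the uniform (normalized Lebesgue)
probability measure on the Gelfand–Zeitlin polytope `P_λ`. -/
theorem pushforward_haar_eq_uniform_gz (n : ℕ) (hn : 0 < n)
    (lam : Fin n → ℝ) (hlam : StrictAnti lam)
    (μH : Measure (Matrix.unitaryGroup (Fin n) ℂ))
    (hprob : IsProbabilityMeasure μH)
    (hinv : ∀ g : Matrix.unitaryGroup (Fin n) ℂ,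
      Measure.map (fun U => g * U) μH = μH) :
    Measure.map (gzPoint n lam) μH =
      (volume (gzPolytope n lam))⁻¹ • volume.restrict (gzPolytope n lam) := by
  obtain ⟨m, rfl⟩ : ∃ m, n = m + 1 := ⟨n - 1, by omega⟩
  exact GZ.main_aux m lam hlam μH hprob hinv
end

section
/- Let N ≥ 1, let S ⊂ ℝ^N be a compact convex set, let ε > 0, and let g : S → ℝ^N be a continuous map satisfying |g(w) − w| < ε for all w ∈ S (Euclidean norm). Then the image g(S) contains every point of S whose distance from the topological boundary of S (in ℝ^N) is greater than ε: {s ∈ S : dist(s, ∂S) > ε} ⊆ g(S). -/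
open Set Metric MeasureTheory Filter Topology

namespace BrouwerAux

variable {N : ℕ}

theorem det_pos_of_norm_lt {E : Type*} [NormedAddCommGroup E] [NormedSpace ℝ E]
    [FiniteDimensional ℝ E] (A : E →L[ℝ] E) (hA : ‖A‖ < 1) :
    0 < (ContinuousLinearMap.id ℝ E + A).det := by
  have hne : ∀ s ∈ Icc (0:ℝ) 1, (ContinuousLinearMap.id ℝ E + s • A).det ≠ 0 := by
    intro s hs h0
    have : ¬ Function.Injective ((ContinuousLinearMap.id ℝ E + s • A : E →L[ℝ] E) : E →ₗ[ℝ] E) := by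
      intro hinj
      have := LinearMap.bot_lt_ker_of_det_eq_zero h0
      rw [LinearMap.ker_eq_bot.2 hinj] at this
      exact lt_irrefl _ this
    apply this
    rw [← LinearMap.ker_eq_bot, LinearMap.ker_eq_bot']
    intro v hv
    have hv' : v + s • A v = 0 := by simpa using hv
    by_contra hne
    have hvp : 0 < ‖v‖ := norm_pos_iff.2 hne
    have h1 : ‖v‖ = ‖s • A v‖ := by
      have := congrArg norm (eq_neg_of_add_eq_zero_left hv')
      rwa [norm_neg] at this
    have h2 : ‖s • A v‖ ≤ ‖A‖ * ‖v‖ := by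
      rw [norm_smul, Real.norm_eq_abs, abs_of_nonneg hs.1]
      calc s * ‖A v‖ ≤ 1 * ‖A v‖ := by gcongr; exact hs.2
        _ ≤ _ := by rw [one_mul]; exact A.le_opNorm v
    nlinarith
  have hcont : Continuous (fun s : ℝ => (ContinuousLinearMap.id ℝ E + s • A).det) :=
    ContinuousLinearMap.continuous_det.comp (by fun_prop)
  by_contra hneg
  push Not at hneg
  have := intermediate_value_Icc' (zero_le_one (α := ℝ)) hcont.continuousOn
  have h0 : (0:ℝ) ∈ Icc ((ContinuousLinearMap.id ℝ E + (1:ℝ) • A).det)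
      ((ContinuousLinearMap.id ℝ E + (0:ℝ) • A).det) := by
    constructor
    · simpa using hneg
    · simp [ContinuousLinearMap.det]
  obtain ⟨s, hs, hs0⟩ := this h0
  exact hne s hs hs0

theorem change_vars (u : EuclideanSpace ℝ (Fin N) → EuclideanSpace ℝ (Fin N))
    (hu : ContDiff ℝ 1 u) (K : NNReal) (hK : LipschitzWith K u) (R : ℝ)
    (hR : ∀ x, R ≤ ‖x‖ → u x = 0) (t : ℝ) (ht : |t| * K < 1)
    (ρ : EuclideanSpace ℝ (Fin N) → ℝ) :
    ∫ x in closedBall (0 : EuclideanSpace ℝ (Fin N)) R,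
      (ContinuousLinearMap.id ℝ _ + t • fderiv ℝ u x).det * ρ (x + t • u x) =
    ∫ x in closedBall (0 : EuclideanSpace ℝ (Fin N)) R, ρ x := by
  set F : EuclideanSpace ℝ (Fin N) → EuclideanSpace ℝ (Fin N) := fun x => x + t • u x with hF
  have hlip : ∀ x y, ‖t • u x - t • u y‖ ≤ |t| * K * ‖x - y‖ := by
    intro x y
    rw [← smul_sub, norm_smul, Real.norm_eq_abs, mul_assoc]
    gcongr
    simpa [dist_eq_norm] using hK.dist_le_mul x y
  have hinj : Function.Injective F := by
    intro x y hxy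
    by_contra hne
    have hp : 0 < ‖x - y‖ := norm_pos_iff.2 (sub_ne_zero.2 hne)
    have h1 : x - y = -(t • u x - t • u y) := by
      have : x + t • u x = y + t • u y := hxy
      rw [eq_neg_iff_add_eq_zero]
      calc x - y + (t • u x - t • u y) = (x + t • u x) - (y + t • u y) := by abel
        _ = 0 := by rw [this, sub_self]
    have h2 := hlip x y
    rw [← norm_neg, ← h1] at h2
    nlinarith
  have hsurj : Function.Surjective F := by
    intro y
    have hc : ContractingWith ⟨|t| * K, by positivity⟩ (fun x => y - t • u x) := by
      refine ⟨by exact_mod_cast ht, LipschitzWith.of_dist_le_mul fun a b => ?_⟩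
      rw [dist_eq_norm, dist_eq_norm]
      have := hlip b a
      rw [norm_sub_rev b a] at this
      rw [sub_sub_sub_cancel_left]
      exact this
    refine ⟨hc.fixedPoint, ?_⟩
    have := hc.fixedPoint_isFixedPt
    have h : y - t • u hc.fixedPoint = hc.fixedPoint := this
    change hc.fixedPoint + t • u hc.fixedPoint = y
    nth_rw 1 [← h]
    abel
  have hout : ∀ x, R ≤ ‖x‖ → F x = x := by
    intro x hx
    simp [hF, hR x hx]
  have himg : F '' closedBall 0 R = closedBall 0 R := by
    ext y
    simp only [mem_image, mem_closedBall, dist_zero_right]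
    constructor
    · rintro ⟨x, hx, rfl⟩
      by_contra hlt
      push Not at hlt
      have := hinj (hout _ hlt.le)
      rw [this] at hlt
      linarith
    · intro hy
      obtain ⟨x, rfl⟩ := hsurj y
      refine ⟨x, ?_, rfl⟩
      by_contra hlt
      push Not at hlt
      rw [hout x hlt.le] at hy
      linarith
  have hder : ∀ x ∈ closedBall (0 : EuclideanSpace ℝ (Fin N)) R,
      HasFDerivWithinAt F (ContinuousLinearMap.id ℝ _ + t • fderiv ℝ u x) (closedBall 0 R) x := by
    intro x _
    have h1 : HasFDerivAt u (fderiv ℝ u x) x :=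
      (hu.differentiable (by norm_num)).differentiableAt.hasFDerivAt
    exact ((hasFDerivAt_id x).add (h1.const_smul t)).hasFDerivWithinAt
  have := integral_image_eq_integral_abs_det_fderiv_smul volume measurableSet_closedBall
    hder hinj.injOn ρ
  rw [himg] at this
  rw [this]
  refine integral_congr_ae (Eventually.of_forall fun x => ?_)
  have hp : 0 < (ContinuousLinearMap.id ℝ _ + t • fderiv ℝ u x).det := by
    apply det_pos_of_norm_lt
    rw [norm_smul, Real.norm_eq_abs]
    refine lt_of_le_of_lt ?_ ht
    gcongr
    exact norm_fderiv_le_of_lipschitz ℝ hK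
  simp only [smul_eq_mul]
  rw [abs_of_pos hp]

/-- polynomial dependence on `t` with continuous coefficients -/
def PolyT {E : Type*} [TopologicalSpace E] (f : ℝ → E → ℝ) : Prop :=
  ∃ P : Polynomial C(E, ℝ), ∀ t x,
    f t x = Polynomial.eval₂RingHom (ContinuousMap.evalAlgHom ℝ ℝ x : C(E, ℝ) →ₐ[ℝ] ℝ).toRingHom t P

section
variable {E : Type*} [TopologicalSpace E]

theorem PolyT.add {f g : ℝ → E → ℝ} (hf : PolyT f) (hg : PolyT g) :
    PolyT (fun t x => f t x + g t x) := by
  obtain ⟨P, hP⟩ := hf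
  obtain ⟨Q, hQ⟩ := hg
  exact ⟨P + Q, fun t x => by rw [map_add, ← hP, ← hQ]⟩

theorem PolyT.mul {f g : ℝ → E → ℝ} (hf : PolyT f) (hg : PolyT g) :
    PolyT (fun t x => f t x * g t x) := by
  obtain ⟨P, hP⟩ := hf
  obtain ⟨Q, hQ⟩ := hg
  exact ⟨P * Q, fun t x => by rw [map_mul, ← hP, ← hQ]⟩

theorem PolyT.pow {f : ℝ → E → ℝ} (hf : PolyT f) (k : ℕ) :
    PolyT (fun t x => f t x ^ k) := by
  obtain ⟨P, hP⟩ := hf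
  exact ⟨P ^ k, fun t x => by rw [map_pow, ← hP]⟩

theorem PolyT.param : PolyT (fun t (_ : E) => t) :=
  ⟨Polynomial.X, fun t x => by simp⟩

theorem PolyT.coeff {a : E → ℝ} (ha : Continuous a) : PolyT (fun _ x => a x) :=
  ⟨Polynomial.C ⟨a, ha⟩, fun t x => by
    rw [Polynomial.coe_eval₂RingHom, Polynomial.eval₂_C]; rfl⟩

theorem PolyT.det {n : ℕ} {A : ℝ → E → Matrix (Fin n) (Fin n) ℝ}
    (hA : ∀ i j, PolyT (fun t x => A t x i j)) : PolyT (fun t x => (A t x).det) := by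
  choose P hP using hA
  refine ⟨(Matrix.of P).det, fun t x => ?_⟩
  rw [RingHom.map_det]
  change (A t x).det = _
  congr 1
  ext i j
  exact hP i j t x
end

theorem PolyT.const_of_local {f : ℝ → EuclideanSpace ℝ (Fin N) → ℝ} (hf : PolyT f) (R c τ : ℝ)
    (hτ : 0 < τ) (h : ∀ t ∈ Ioo 0 τ, ∫ x in closedBall (0 : EuclideanSpace ℝ (Fin N)) R, f t x = c)
    (t : ℝ) : ∫ x in closedBall (0 : EuclideanSpace ℝ (Fin N)) R, f t x = c := by
  obtain ⟨P, hP⟩ := hf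
  let Q : Polynomial ℝ := ∑ i ∈ Finset.range (P.natDegree + 1),
    Polynomial.C (∫ x in closedBall (0 : EuclideanSpace ℝ (Fin N)) R, P.coeff i x) * Polynomial.X ^ i
  have hQ : ∀ t, ∫ x in closedBall (0 : EuclideanSpace ℝ (Fin N)) R, f t x = Q.eval t := by
    intro t
    have : ∀ x, f t x = ∑ i ∈ Finset.range (P.natDegree + 1), P.coeff i x * t ^ i := by
      intro x
      rw [hP]
      rw [Polynomial.coe_eval₂RingHom, Polynomial.eval₂_eq_sum_range]
      rfl
    simp only [this]
    rw [integral_finsetSum]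
    · simp [Q, Polynomial.eval_finsetSum, integral_mul_const]
    · intro i _
      apply ContinuousOn.integrableOn_compact (isCompact_closedBall _ _)
      fun_prop
  have : Q = Polynomial.C c := by
    apply Polynomial.eq_of_infinite_eval_eq
    apply (Ioo_infinite hτ).mono
    intro t ht
    simp [← hQ, h t ht]
  rw [hQ, this, Polynomial.eval_C]

theorem surj_smooth (u : EuclideanSpace ℝ (Fin N) → EuclideanSpace ℝ (Fin N))
    (hu : ContDiff ℝ 1 u) (R : ℝ) (hRpos : 0 < R)
    (hR : ∀ x, R ≤ ‖x‖ → u x = 0) (δ : ℝ) (hδ : 0 < δ) : ∃ x, ‖x + u x‖ < δ := by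
  by_contra hcon
  push Not at hcon
  have hsupp : HasCompactSupport u := by
    apply HasCompactSupport.intro (isCompact_closedBall (0 : EuclideanSpace ℝ (Fin N)) R)
    intro x hx
    apply hR
    simp at hx
    exact hx.le
  obtain ⟨K, hK⟩ := ContDiff.lipschitzWith_of_hasCompactSupport (𝕂 := ℝ) hsupp hu (by norm_num)
  have hdu : Continuous (fderiv ℝ u) := hu.continuous_fderiv (by norm_num)
  have huc : Continuous u := hu.continuous
  have key : ∀ M : ℝ, ∀ k : ℕ,
      ∫ x in closedBall (0 : EuclideanSpace ℝ (Fin N)) R,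
        (ContinuousLinearMap.id ℝ _ + fderiv ℝ u x).det * (M - ‖x + u x‖ ^ 2) ^ k =
      ∫ x in closedBall (0 : EuclideanSpace ℝ (Fin N)) R, (M - ‖x‖ ^ 2) ^ k := by
    intro M k
    have hpoly : PolyT (fun (t : ℝ) (x : EuclideanSpace ℝ (Fin N)) =>
        (ContinuousLinearMap.id ℝ _ + t • fderiv ℝ u x).det * (M - ‖x + t • u x‖ ^ 2) ^ k) := by
      refine PolyT.mul ?_ (PolyT.pow ?_ k)
      · let b := (EuclideanSpace.basisFun (Fin N) ℝ).toBasis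
        have hd : ∀ (t : ℝ) (x : EuclideanSpace ℝ (Fin N)),
            (ContinuousLinearMap.id ℝ _ + t • fderiv ℝ u x).det =
            (Matrix.of fun i j => (1 : Matrix (Fin N) (Fin N) ℝ) i j +
              t * (fderiv ℝ u x (b j)) i).det := by
          intro t x
          rw [ContinuousLinearMap.det, ← LinearMap.det_toMatrix b]
          congr 1
          ext i j
          simp [LinearMap.toMatrix_apply, b, Matrix.one_apply]
          
        simp only [hd]
        apply PolyT.det
        intro i j
        simp only [Matrix.of_apply]
        refine (PolyT.coeff continuous_const).add (PolyT.param.mul (PolyT.coeff ?_))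
        fun_prop
      · have : ∀ (t : ℝ) (x : EuclideanSpace ℝ (Fin N)), M - ‖x + t • u x‖ ^ 2 =
            (M - ‖x‖ ^ 2) + t * (-2 * inner ℝ x (u x) + t * (-‖u x‖ ^ 2)) := by
          intro t x
          rw [norm_add_sq_real, norm_smul, inner_smul_right, mul_pow, Real.norm_eq_abs, sq_abs]
          ring
        simp only [this]
        exact (PolyT.coeff (by fun_prop)).add (PolyT.param.mul ((PolyT.coeff (by fun_prop)).add
          (PolyT.param.mul (PolyT.coeff (by fun_prop)))))
    have := hpoly.const_of_local R (∫ x in closedBall (0 : EuclideanSpace ℝ (Fin N)) R,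
      (M - ‖x‖ ^ 2) ^ k) (1 / (K + 1)) (by positivity) (by
        intro t ht
        apply change_vars u hu K hK R hR t _ (fun y => (M - ‖y‖ ^ 2) ^ k)
        rw [abs_of_pos ht.1]
        have h2 := ht.2
        rw [lt_div_iff₀ (by positivity)] at h2
        linarith [ht.1]) 1
    simpa using this
  -- bounds
  have hdetc : Continuous (fun x => (ContinuousLinearMap.id ℝ (EuclideanSpace ℝ (Fin N))
      + fderiv ℝ u x).det) :=
    ContinuousLinearMap.continuous_det.comp (by fun_prop)
  obtain ⟨C, hC⟩ := (isCompact_closedBall (0 : EuclideanSpace ℝ (Fin N)) R).exists_bound_of_continuousOn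
    hdetc.continuousOn
  obtain ⟨L, hL⟩ := (isCompact_closedBall (0 : EuclideanSpace ℝ (Fin N)) R).exists_bound_of_continuousOn
    (f := fun x => x + u x) (by fun_prop)
  set η := min δ R / 2 with hη
  have hηpos : 0 < η := by positivity
  have hηδ : η < δ := by have := min_le_left δ R; rw [hη]; linarith
  have hηR : η ≤ R := by have := min_le_right δ R; rw [hη]; linarith
  set M := L ^ 2 + R ^ 2 + δ ^ 2 + 1 with hM
  set V := volume.real (closedBall (0 : EuclideanSpace ℝ (Fin N)) R) with hV
  set W := volume.real (closedBall (0 : EuclideanSpace ℝ (Fin N)) η) with hW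
  have hWpos : 0 < W := by
    rw [hW, measureReal_def]
    exact ENNReal.toReal_pos (measure_closedBall_pos _ _ hηpos).ne' measure_closedBall_lt_top.ne
  have hineq : ∀ k : ℕ, (M - η ^ 2) ^ k * W ≤ (C * (M - δ ^ 2) ^ k) * V := by
    intro k
    have h1 : (M - η ^ 2) ^ k * W ≤
        ∫ x in closedBall (0 : EuclideanSpace ℝ (Fin N)) R, (M - ‖x‖ ^ 2) ^ k := by
      calc (M - η ^ 2) ^ k * W
          = ∫ x in closedBall (0 : EuclideanSpace ℝ (Fin N)) η, (M - η ^ 2) ^ k := by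
            rw [setIntegral_const, smul_eq_mul, mul_comm]
        _ ≤ ∫ x in closedBall (0 : EuclideanSpace ℝ (Fin N)) η, (M - ‖x‖ ^ 2) ^ k := by
            apply setIntegral_mono_on
            · exact (continuous_const.continuousOn).integrableOn_compact (isCompact_closedBall _ _)
            · exact ContinuousOn.integrableOn_compact (isCompact_closedBall _ _) (by fun_prop)
            · exact measurableSet_closedBall
            · intro x hx
              simp at hx
              apply pow_le_pow_left₀
              · rw [hM]; nlinarith
              · gcongr
        _ ≤ _ := by
            apply setIntegral_mono_set
            · exact ContinuousOn.integrableOn_compact (isCompact_closedBall _ _) (by fun_prop)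
            · refine (ae_restrict_iff' measurableSet_closedBall).2 (Eventually.of_forall fun x hx => ?_)
              simp at hx
              apply pow_nonneg
              rw [hM]
              nlinarith [norm_nonneg x]
            · exact (closedBall_subset_closedBall hηR).eventuallyLE
    rw [← key M k] at h1
    refine h1.trans ((le_abs_self _).trans ?_)
    rw [← Real.norm_eq_abs]
    apply norm_setIntegral_le_of_norm_le_const measure_closedBall_lt_top
    intro x hx
    rw [norm_mul]
    have hl := hL x hx
    have hd := hcon x
    have hc := hC x hx
    have h0 : 0 ≤ M - ‖x + u x‖ ^ 2 := by
      rw [hM]; nlinarith [norm_nonneg (x + u x)]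
    rw [norm_pow, Real.norm_of_nonneg h0]
    gcongr
    exact (norm_nonneg _).trans hc
  have ha : 0 < M - δ ^ 2 := by rw [hM]; nlinarith [sq_nonneg L, sq_nonneg R]
  have hab : 1 < (M - η ^ 2) / (M - δ ^ 2) := by
    rw [one_lt_div ha]; nlinarith
  obtain ⟨k, hk⟩ := ((tendsto_pow_atTop_atTop_of_one_lt hab).eventually_gt_atTop (C * V / W)).exists
  rw [div_pow, div_lt_div_iff₀ hWpos (by positivity)] at hk
  have := hineq k
  nlinarith

/-- Continuous version on a ball. -/
theorem exists_zero (r : ℝ) (hr : 0 < r)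
    (v : EuclideanSpace ℝ (Fin N) → EuclideanSpace ℝ (Fin N))
    (hv : ContinuousOn v (closedBall 0 r)) (hlt : ∀ x ∈ closedBall 0 r, ‖v x‖ < r) :
    ∃ x ∈ closedBall (0 : EuclideanSpace ℝ (Fin N)) r, x + v x = 0 := by
  by_contra hcon
  push Not at hcon
  have hcpt := isCompact_closedBall (0 : EuclideanSpace ℝ (Fin N)) r
  have hne : (closedBall (0 : EuclideanSpace ℝ (Fin N)) r).Nonempty := ⟨0, by simp [hr.le]⟩
  obtain ⟨x₁, hx₁, hmin⟩ := hcpt.exists_isMinOn hne (f := fun x => ‖x + v x‖) (by fun_prop)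
  obtain ⟨x₂, hx₂, hmax⟩ := hcpt.exists_isMaxOn hne (f := fun x => ‖v x‖) (by fun_prop)
  have hδ1 : 0 < ‖x₁ + v x₁‖ := norm_pos_iff.2 (hcon x₁ hx₁)
  have hδ2 : 0 < r - ‖v x₂‖ := by linarith [hlt x₂ hx₂]
  set δ := min ‖x₁ + v x₁‖ (r - ‖v x₂‖) with hδ
  have hδpos : 0 < δ := lt_min hδ1 hδ2
  let p : EuclideanSpace ℝ (Fin N) → EuclideanSpace ℝ (Fin N) := fun x => (r / max r ‖x‖) • x
  have hmaxpos : ∀ x : EuclideanSpace ℝ (Fin N), 0 < max r ‖x‖ := fun x => lt_max_of_lt_left hr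
  have hpc : Continuous p := by
    have h1 : Continuous fun x : EuclideanSpace ℝ (Fin N) => r / max r ‖x‖ :=
      continuous_const.div (by fun_prop) fun x => (hmaxpos x).ne'
    exact h1.smul continuous_id
  have hpm : ∀ x, p x ∈ closedBall (0 : EuclideanSpace ℝ (Fin N)) r := by
    intro x
    simp only [p, mem_closedBall, dist_zero_right, norm_smul, Real.norm_eq_abs]
    rw [abs_of_pos (div_pos hr (hmaxpos x)), div_mul_eq_mul_div, div_le_iff₀ (hmaxpos x)]
    gcongr
    exact le_max_right _ _
  have hpe : ∀ x, ‖x‖ ≤ r → p x = x := by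
    intro x hx
    simp [p, max_eq_left hx, hr.ne']
  let χ : EuclideanSpace ℝ (Fin N) → ℝ := fun x => max 0 (min 1 (2 - ‖x‖ / r))
  let w : EuclideanSpace ℝ (Fin N) → EuclideanSpace ℝ (Fin N) := fun x => χ x • v (p x)
  have hwc : Continuous w := by
    have h1 : Continuous χ := by fun_prop
    exact h1.smul (hv.comp_continuous hpc hpm)
  have hfar : ∀ x, δ ≤ ‖x + w x‖ := by
    intro x
    by_cases hx : ‖x‖ ≤ r
    · have hχ : χ x = 1 := by
        have : ‖x‖ / r ≤ 1 := (div_le_one hr).2 hx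
        simp only [χ]
        rw [min_eq_left (by linarith), max_eq_right zero_le_one]
      simp only [w, hχ, hpe x hx, one_smul]
      exact (min_le_left _ _).trans (hmin (by simpa using hx))
    · push Not at hx
      have hw : ‖w x‖ ≤ ‖v x₂‖ := by
        have h0 : 0 ≤ χ x := le_max_left _ _
        have h1 : χ x ≤ 1 := max_le zero_le_one (min_le_left _ _)
        simp only [w, norm_smul, Real.norm_eq_abs, abs_of_nonneg h0]
        have : ‖v (p x)‖ ≤ ‖v x₂‖ := hmax (hpm x)
        nlinarith [norm_nonneg (v (p x))]
      have h3 : ‖x‖ - ‖w x‖ ≤ ‖x + w x‖ := by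
        simpa using norm_sub_norm_le x (-(w x))
      have := min_le_right ‖x₁ + v x₁‖ (r - ‖v x₂‖)
      linarith
  obtain ⟨u, huC, hud, hus⟩ := hwc.exists_contDiff_approx 1 (ε := fun _ => δ / 2) continuous_const
    (fun _ => by positivity)
  obtain ⟨x, hx⟩ := surj_smooth u huC (2 * r) (by positivity) (by
    intro x hx
    by_contra hne
    apply hus hne
    have : 2 ≤ ‖x‖ / r := by rwa [le_div_iff₀ hr]
    have hχ : χ x = 0 := by
      simp only [χ]
      exact max_eq_left ((min_le_right _ _).trans (by linarith))
    simp [w, hχ]) (δ / 2) (by positivity)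
  have h1 := hfar x
  have h2 := hud x
  rw [dist_eq_norm, norm_sub_rev] at h2
  have h3 : ‖x + w x‖ ≤ ‖x + u x‖ + ‖w x - u x‖ := by
    refine le_trans (le_of_eq ?_) (norm_add_le _ _)
    congr 1
    abel
  linarith

end BrouwerAux

/-- Degree-theoretic lemma: if `S ⊂ ℝᴺ` is compact and convex and `g : S → ℝᴺ` is a
continuous map with `|g(w) − w| < ε` on `S`, then the image `g(S)` contains every
point of `S` at distance greater than `ε` from the boundary `∂S`. -/
theorem image_contains_points_far_from_boundary (N : ℕ) (hN : 1 ≤ N)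
    (S : Set (EuclideanSpace ℝ (Fin N))) (hScomp : IsCompact S) (hSconv : Convex ℝ S)
    (ε : ℝ) (hε : 0 < ε)
    (g : EuclideanSpace ℝ (Fin N) → EuclideanSpace ℝ (Fin N))
    (hg : ContinuousOn g S) (hclose : ∀ w ∈ S, ‖g w - w‖ < ε) :
    {s ∈ S | ε < Metric.infDist s (frontier S)} ⊆ g '' S := by
  rintro s ⟨hs, hsd⟩
  have hball : ∀ x ∈ closedBall (0 : EuclideanSpace ℝ (Fin N)) ε, s + x ∈ S := by
    intro x hx
    by_contra hnot
    have hne : S ≠ univ := fun h => hnot (h ▸ mem_univ _)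
    obtain ⟨y, hy, hyd⟩ := exists_mem_frontier_infDist_compl_eq_dist hs hne
    have h1 : infDist s (frontier S) ≤ dist s y := infDist_le_dist_of_mem hy
    have h2 : infDist s Sᶜ ≤ dist s (s + x) := infDist_le_dist_of_mem hnot
    simp at h2 hx
    linarith
  obtain ⟨x, hx, hx0⟩ := BrouwerAux.exists_zero ε hε (fun x => g (s + x) - (s + x)) (by
      refine ContinuousOn.sub ?_ (by fun_prop)
      exact hg.comp (by fun_prop) hball) (fun x hx => hclose _ (hball x hx))
  refine ⟨s + x, hball x hx, ?_⟩
  have : x + (g (s + x) - (s + x)) = g (s + x) - s := by abel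
  rw [this] at hx0
  exact sub_eq_zero.1 hx0
end
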